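/- arXiv:1210.6341 — 2 statements merged into one kernel-verified Lean document; each statement's English description precedes it below -/
import Mathlib

section
/- (Specialization with no eavesdropper.) Consider a broadcast channel with asymmetric side information: finite sets 𝒳, 𝒮₁, 𝒮₂, 𝒴₁, 𝒴₂, states (S₁,S₂) i.i.d. from P_s ∈ Δ(𝒮₁×𝒮₂) known non-causally at the encoder, decoder k knowing S_kⁿ, and memoryless kernel T : 𝒳×𝒮₁×𝒮₂ → Δ(𝒴₁×𝒴₂). For any finite auxiliary alphabets 𝒰₁, 𝒰₂ and conditional distribution ℙ(u₁,u₂,x|s₁,s₂), any rate pair satisfying R₁ ≤ I(U₁;Y₁,S₁) − I(U₁;S₁,S₂), R₂ ≤ I(U₂;Y₂,S₂) − I(U₂;S₁,S₂), and R₁+R₂ ≤ I(U₁;Y₁,S₁) + I(U₂;Y₂,S₂) − I(U₁;U₂) − I(U₁,U₂;S₁,S₂) is achievable: for every ε > 0 there exist n and a code f : ℳ₁×ℳ₂×𝒮₁ⁿ×𝒮₂ⁿ → 𝒳ⁿ, g₁ : 𝒴₁ⁿ×𝒮₁ⁿ → ℳ₁, g₂ : 𝒴₂ⁿ×𝒮₂ⁿ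 → ℳ₂ with (log|ℳ_k|)/n ≥ R_k − ε for k = 1,2 and error probability ℙ((m₁,m₂) ≠ (m̂₁,m̂₂)) ≤ ε. -/
open scoped BigOperators

/-- A probability mass function on a finite alphabet. -/
def IsPMF {α : Type*} [Fintype α] (p : α → ℝ) : Prop :=
  (∀ a, 0 ≤ p a) ∧ ∑ a, p a = 1

/-- Shannon entropy (in nats) of a pmf on a finite alphabet. -/
noncomputable def ent {α : Type*} [Fintype α] (p : α → ℝ) : ℝ :=
  ∑ a, Real.negMulLog (p a)

open Classical in
/-- Pushforward (law) of a random variable `X` under a pmf `μ` on a finite space `Ω`. -/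
noncomputable def push {Ω : Type*} {α : Type*} [Fintype Ω] (μ : Ω → ℝ) (X : Ω → α) :
    α → ℝ :=
  fun a => ∑ ω, if X ω = a then μ ω else 0

/-- Entropy `H(X)` of a finitely-valued random variable under `μ`. -/
noncomputable def entRV {Ω α : Type*} [Fintype Ω] [Fintype α] (μ : Ω → ℝ) (X : Ω → α) : ℝ :=
  ent (push μ X)

/-- Conditional entropy `H(X | Y)` under `μ`. -/
noncomputable def condEntRV {Ω α β : Type*} [Fintype Ω] [Fintype α] [Fintype β]
    (μ : Ω → ℝ) (X : Ω → α) (Y : Ω → β) : ℝ :=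
  entRV μ (fun ω => (X ω, Y ω)) - entRV μ Y

/-- Mutual information `I(X ; Y)` under `μ`. -/
noncomputable def miRV {Ω α β : Type*} [Fintype Ω] [Fintype α] [Fintype β]
    (μ : Ω → ℝ) (X : Ω → α) (Y : Ω → β) : ℝ :=
  entRV μ X + entRV μ Y - entRV μ (fun ω => (X ω, Y ω))

section BroadcastSI

variable {X S1 S2 Y1 Y2 : Type*}
  [Fintype X] [Fintype S1] [Fintype S2] [Fintype Y1] [Fintype Y2]

/-- Joint pmf of (messages, state sequences, output sequences) induced by a code on
the memoryless broadcast channel `T` with i.i.d. states from `Ps` known non-causally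
at the encoder, decoder `k` knowing its own state sequence. -/
noncomputable def codePMF (Ps : S1 × S2 → ℝ) (T : X → S1 → S2 → Y1 × Y2 → ℝ)
    (n M₁ M₂ : ℕ)
    (f : Fin M₁ → Fin M₂ → (Fin n → S1) → (Fin n → S2) → Fin n → X) :
    (Fin M₁ × Fin M₂) × (Fin n → S1 × S2) × (Fin n → Y1 × Y2) → ℝ :=
  fun q =>
    ((M₁ : ℝ) * (M₂ : ℝ))⁻¹ * (∏ i, Ps (q.2.1 i)) *
      ∏ i, T (f q.1.1 q.1.2 (fun j => (q.2.1 j).1) (fun j => (q.2.1 j).2) i)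
        (q.2.1 i).1 (q.2.1 i).2 (q.2.2 i)

open Classical in
/-- Error probability of the two decoders. -/
noncomputable def errProb (Ps : S1 × S2 → ℝ) (T : X → S1 → S2 → Y1 × Y2 → ℝ)
    (n M₁ M₂ : ℕ)
    (f : Fin M₁ → Fin M₂ → (Fin n → S1) → (Fin n → S2) → Fin n → X)
    (g₁ : (Fin n → Y1) → (Fin n → S1) → Fin M₁)
    (g₂ : (Fin n → Y2) → (Fin n → S2) → Fin M₂) : ℝ :=
  ∑ q : (Fin M₁ × Fin M₂) × (Fin n → S1 × S2) × (Fin n → Y1 × Y2),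
    if g₁ (fun i => (q.2.2 i).1) (fun i => (q.2.1 i).1) = q.1.1 ∧
       g₂ (fun i => (q.2.2 i).2) (fun i => (q.2.1 i).2) = q.1.2
    then 0 else codePMF Ps T n M₁ M₂ f q

/-- The joint law `ℚ(u₁,u₂,x,s₁,s₂,y₁,y₂) = P_s(s₁,s₂)·ℙ(u₁,u₂,x|s₁,s₂)·T(y₁,y₂|x,s₁,s₂)`. -/
noncomputable def jointQ {U1 U2 : Type*} (Ps : S1 × S2 → ℝ)
    (T : X → S1 → S2 → Y1 × Y2 → ℝ) (Pc : S1 → S2 → U1 × U2 × X → ℝ) :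
    (U1 × U2 × X) × (S1 × S2) × (Y1 × Y2) → ℝ :=
  fun q => Ps q.2.1 * Pc q.2.1.1 q.2.1.2 q.1 * T q.1.2.2 q.2.1.1 q.2.1.2 q.2.2

end BroadcastSI

/-! ### Expectations on finite alphabets -/

/-- Expectation of `F` under the weights `p`. -/
noncomputable def expect {α : Type*} [Fintype α] (p F : α → ℝ) : ℝ := ∑ a, p a * F a

/-- The i.i.d. extension of `p` to families indexed by `ι`. -/
noncomputable def iidPMF {ι α : Type*} [Fintype ι] (p : α → ℝ) : (ι → α) → ℝ :=
  fun c => ∏ i, p (c i)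

section Expect

variable {α β ι : Type*} [Fintype α] [Fintype β]

lemma expect_add (p F G : α → ℝ) :
    expect p (fun a => F a + G a) = expect p F + expect p G := by
  simp [expect, mul_add, Finset.sum_add_distrib]

lemma expect_sub (p F G : α → ℝ) :
    expect p (fun a => F a - G a) = expect p F - expect p G := by
  simp [expect, mul_sub, Finset.sum_sub_distrib]

lemma expect_const_mul (p F : α → ℝ) (r : ℝ) :
    expect p (fun a => r * F a) = r * expect p F := by
  simp only [expect, Finset.mul_sum]
  exact Finset.sum_congr rfl fun a _ => by ring

lemma expect_mul_const (p F : α → ℝ) (r : ℝ) :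
    expect p (fun a => F a * r) = expect p F * r := by
  simp only [expect, Finset.sum_mul]
  exact Finset.sum_congr rfl fun a _ => by ring

lemma expect_sum (p : α → ℝ) (s : Finset ι) (F : ι → α → ℝ) :
    expect p (fun a => ∑ i ∈ s, F i a) = ∑ i ∈ s, expect p (F i) := by
  simp only [expect, Finset.mul_sum]
  exact Finset.sum_comm

lemma expect_const {p : α → ℝ} (hp : IsPMF p) (r : ℝ) : expect p (fun _ => r) = r := by
  simp [expect, ← Finset.sum_mul, hp.2]

lemma expect_mono {p F G : α → ℝ} (hp : IsPMF p) (h : ∀ a, F a ≤ G a) :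
    expect p F ≤ expect p G :=
  Finset.sum_le_sum fun a _ => mul_le_mul_of_nonneg_left (h a) (hp.1 a)

lemma expect_nonneg {p F : α → ℝ} (hp : IsPMF p) (h : ∀ a, 0 ≤ F a) : 0 ≤ expect p F :=
  Finset.sum_nonneg fun a _ => mul_nonneg (hp.1 a) (h a)

lemma expect_comm (p : α → ℝ) (q : β → ℝ) (F : α → β → ℝ) :
    expect p (fun a => expect q (F a)) = expect q (fun b => expect p fun a => F a b) := by
  simp only [expect, Finset.mul_sum]
  rw [Finset.sum_comm]
  exact Finset.sum_congr rfl fun a _ => Finset.sum_congr rfl fun b _ => by ring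

lemma exists_le_expect {p F : α → ℝ} (hp : IsPMF p) : ∃ a, F a ≤ expect p F := by
  by_contra! h
  have hpos : ∃ a, 0 < p a := by
    by_contra! h0
    have := Finset.sum_nonpos fun a (_ : a ∈ Finset.univ) => h0 a
    linarith [hp.2]
  obtain ⟨a, ha⟩ := hpos
  have : ∑ b, p b * expect p F < ∑ b, p b * F b :=
    Finset.sum_lt_sum (fun b _ => mul_le_mul_of_nonneg_left (h b).le (hp.1 b))
      ⟨a, Finset.mem_univ a, mul_lt_mul_of_pos_left (h a) ha⟩
  rw [← Finset.sum_mul, hp.2, one_mul] at this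
  exact lt_irrefl _ this

variable [Fintype ι] [DecidableEq ι]

lemma sum_pi_prod (F : ι → α → ℝ) : ∑ c : ι → α, ∏ i, F i (c i) = ∏ i, ∑ a, F i a := by
  rw [Finset.prod_univ_sum, Fintype.piFinset_univ]

lemma isPMF_iidPMF {p : α → ℝ} (hp : IsPMF p) : IsPMF (iidPMF p : (ι → α) → ℝ) :=
  ⟨fun _ => Finset.prod_nonneg fun _ _ => hp.1 _, by
    simp [iidPMF, sum_pi_prod (fun _ : ι => p), hp.2]⟩

lemma expect_iidPMF_mul {p : α → ℝ} (hp : IsPMF p) {i j : ι} (hij : i ≠ j) (g h : α → ℝ) :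
    expect (iidPMF p) (fun c : ι → α => g (c i) * h (c j)) = expect p g * expect p h := by
  have key : ∀ c : ι → α, iidPMF p c * (g (c i) * h (c j)) =
      ∏ k, p (c k) * ((if k = i then g (c k) else 1) * (if k = j then h (c k) else 1)) := by
    intro c
    rw [Finset.prod_mul_distrib, Finset.prod_mul_distrib]
    simp [iidPMF]
  unfold expect
  rw [Finset.sum_congr rfl fun c _ => key c,
    sum_pi_prod (fun k a => p a * ((if k = i then g a else 1) * (if k = j then h a else 1))),
    Finset.prod_eq_mul i j hij]
  · simp [hij, hij.symm]
  · intro k _ hk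
    simp [hk.1, hk.2, hp.2]
  · simp
  · simp

lemma expect_iidPMF_apply {p : α → ℝ} (hp : IsPMF p) (i : ι) (g : α → ℝ) :
    expect (iidPMF p) (fun c : ι → α => g (c i)) = expect p g := by
  have key : ∀ c : ι → α, iidPMF p c * g (c i) =
      ∏ k, p (c k) * (if k = i then g (c k) else 1) := by
    intro c
    rw [Finset.prod_mul_distrib]
    simp [iidPMF]
  unfold expect
  rw [Finset.sum_congr rfl fun c _ => key c,
    sum_pi_prod (fun k a => p a * (if k = i then g a else 1)), Finset.prod_eq_single i]
  · simp
  · intro k _ hk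
    simp [hk, hp.2]
  · simp

end Expect

/-! ### Random codebooks -/

section Codebook

variable {ι κ U V : Type*} [Fintype ι] [DecidableEq ι] [Fintype κ] [DecidableEq κ]
  [Fintype U] [Fintype V]

lemma expect_codebook_apply {p : U → ℝ} {q : V → ℝ} (hp : IsPMF p) (hq : IsPMF q)
    (i : ι) (j : κ) (F : U → V → ℝ) :
    expect (iidPMF p) (fun c : ι → U => expect (iidPMF q) fun d : κ → V => F (c i) (d j)) =
      expect p fun u => expect q (F u) := by
  rw [← expect_iidPMF_apply hp i]
  congr 1
  funext c
  exact expect_iidPMF_apply hq j _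

/-- Covariance of two entries of the random matrix `ω (c i) (d j)`. -/
lemma cov_codebook_le {p : U → ℝ} {q : V → ℝ} (hp : IsPMF p) (hq : IsPMF q)
    (ω : U → V → ℝ) (hω : ∀ u v, 0 ≤ ω u v) {μ b b₁ b₂ : ℝ}
    (hμ : μ = expect p fun u => expect q (ω u)) (hμ1 : μ ≤ 1)
    (hb0 : 0 ≤ b) (hb₁0 : 0 ≤ b₁) (hb₂0 : 0 ≤ b₂)
    (hb : ∀ u v, ω u v ≤ b) (hb₁ : ∀ u, expect q (ω u) ≤ b₁)
    (hb₂ : ∀ v, expect p (fun u => ω u v) ≤ b₂) (i i' : ι) (j j' : κ) :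
    expect (iidPMF p) (fun c : ι → U => expect (iidPMF q) fun d : κ → V =>
      (ω (c i) (d j) - μ) * (ω (c i') (d j') - μ)) ≤
      (if i = i' then if j = j' then b else 0 else 0) + (if i = i' then b₁ else 0) +
        (if j = j' then b₂ else 0) := by
  have hP := isPMF_iidPMF (ι := ι) hp
  have hQ := isPMF_iidPMF (ι := κ) hq
  have expand : expect (iidPMF p) (fun c : ι → U => expect (iidPMF q) fun d : κ → V =>
      (ω (c i) (d j) - μ) * (ω (c i') (d j') - μ)) =
      expect (iidPMF p) (fun c : ι → U => expect (iidPMF q) fun d : κ → V =>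
        ω (c i) (d j) * ω (c i') (d j')) - μ * μ := by
    have h1 : ∀ (c : ι → U) (d : κ → V), (ω (c i) (d j) - μ) * (ω (c i') (d j') - μ) =
        ω (c i) (d j) * ω (c i') (d j') - (μ * ω (c i) (d j) + (μ * ω (c i') (d j') - μ * μ)) :=
      fun c d => by ring
    simp only [h1, expect_sub, expect_add, expect_const_mul, expect_const hQ, expect_const hP,
      expect_codebook_apply hp hq]
    rw [← hμ]
    ring
  have hμ0 : 0 ≤ μ := hμ ▸ expect_nonneg hp fun u => expect_nonneg hq (hω u)
  have hμμ : 0 ≤ μ * μ := mul_nonneg hμ0 hμ0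
  rw [expand]
  by_cases hi : i = i'
  · subst hi
    by_cases hj : j = j'
    · subst hj
      rw [expect_codebook_apply hp hq i j fun u v => ω u v * ω u v]
      have : (expect p fun u => expect q fun v => ω u v * ω u v) ≤ b * μ := by
        rw [hμ, ← expect_const_mul]
        refine expect_mono hp fun u => ?_
        rw [← expect_const_mul]
        exact expect_mono hq fun v => mul_le_mul_of_nonneg_right (hb u v) (hω u v)
      have : b * μ ≤ b := mul_le_of_le_one_right hb0 hμ1
      simp only [if_true]
      linarith
    · have : (expect (iidPMF p) fun c : ι → U => expect (iidPMF q) fun d : κ → V =>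
          ω (c i) (d j) * ω (c i) (d j')) ≤ b₁ * μ := by
        simp only [fun c : ι → U => expect_iidPMF_mul hq hj (ω (c i)) (ω (c i))]
        rw [expect_iidPMF_apply hp i fun u => expect q (ω u) * expect q (ω u), hμ,
          ← expect_const_mul]
        exact expect_mono hp fun u =>
          mul_le_mul_of_nonneg_right (hb₁ u) (expect_nonneg hq (hω u))
      have : b₁ * μ ≤ b₁ := mul_le_of_le_one_right hb₁0 hμ1
      simp only [if_true, hj, if_false]
      linarith
  · rw [expect_comm]
    simp only [fun d : κ → V =>
      expect_iidPMF_mul hp hi (fun u => ω u (d j)) (fun u => ω u (d j'))]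
    by_cases hj : j = j'
    · subst hj
      have : (expect (iidPMF q) fun d : κ → V =>
          expect p (fun u => ω u (d j)) * expect p (fun u => ω u (d j))) ≤ b₂ * μ := by
        rw [expect_iidPMF_apply hq j fun v => expect p (fun u => ω u v) * expect p fun u => ω u v,
          hμ, expect_comm, ← expect_const_mul]
        exact expect_mono hq fun v =>
          mul_le_mul_of_nonneg_right (hb₂ v) (expect_nonneg hp fun u => hω u v)
      have : b₂ * μ ≤ b₂ := mul_le_of_le_one_right hb₂0 hμ1
      simp only [if_true, hi, if_false]
      linarith
    · rw [expect_iidPMF_mul hq hj (fun v => expect p fun u => ω u v)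
        (fun v => expect p fun u => ω u v), expect_comm q p, ← hμ]
      simp [hi, hj]

/-- Second-moment bound for the empirical mean of `ω` over a random codebook. -/
lemma var_codebook_le {Λ₁ Λ₂ : Type*} [Fintype Λ₁] [DecidableEq Λ₁] [Fintype Λ₂] [DecidableEq Λ₂]
    [Nonempty Λ₁] [Nonempty Λ₂]
    {e₁ : Λ₁ → ι} {e₂ : Λ₂ → κ} (he₁ : e₁.Injective) (he₂ : e₂.Injective)
    {p : U → ℝ} {q : V → ℝ} (hp : IsPMF p) (hq : IsPMF q)
    (ω : U → V → ℝ) (hω : ∀ u v, 0 ≤ ω u v) {μ b b₁ b₂ : ℝ}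
    (hμ : μ = expect p fun u => expect q (ω u)) (hμ1 : μ ≤ 1)
    (hb0 : 0 ≤ b) (hb₁0 : 0 ≤ b₁) (hb₂0 : 0 ≤ b₂)
    (hb : ∀ u v, ω u v ≤ b) (hb₁ : ∀ u, expect q (ω u) ≤ b₁)
    (hb₂ : ∀ v, expect p (fun u => ω u v) ≤ b₂) :
    expect (iidPMF p) (fun c : ι → U => expect (iidPMF q) fun d : κ → V =>
      (μ - ((Fintype.card Λ₁ : ℝ) * Fintype.card Λ₂)⁻¹ *
        ∑ l : Λ₁ × Λ₂, ω (c (e₁ l.1)) (d (e₂ l.2))) ^ 2) ≤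
      b / (Fintype.card Λ₁ * Fintype.card Λ₂) + b₁ / Fintype.card Λ₁ +
        b₂ / Fintype.card Λ₂ := by
  set L₁ : ℝ := (Fintype.card Λ₁ : ℝ) with hL₁
  set L₂ : ℝ := (Fintype.card Λ₂ : ℝ) with hL₂
  have hL₁0 : 0 < L₁ := by rw [hL₁]; exact_mod_cast Fintype.card_pos
  have hL₂0 : 0 < L₂ := by rw [hL₂]; exact_mod_cast Fintype.card_pos
  have hsq : ∀ (c : ι → U) (d : κ → V),
      (μ - (L₁ * L₂)⁻¹ * ∑ l : Λ₁ × Λ₂, ω (c (e₁ l.1)) (d (e₂ l.2))) ^ 2 =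
      ((L₁ * L₂)⁻¹) ^ 2 * ∑ l : Λ₁ × Λ₂, ∑ l' : Λ₁ × Λ₂,
        (ω (c (e₁ l.1)) (d (e₂ l.2)) - μ) * (ω (c (e₁ l'.1)) (d (e₂ l'.2)) - μ) := by
    intro c d
    rw [← Finset.sum_mul_sum, Finset.sum_sub_distrib, Finset.sum_const, Finset.card_univ,
      Fintype.card_prod, nsmul_eq_mul]
    push_cast
    rw [← hL₁, ← hL₂]
    field_simp
    ring
  simp only [hsq, expect_const_mul, expect_sum]
  calc ((L₁ * L₂)⁻¹) ^ 2 * ∑ l : Λ₁ × Λ₂, ∑ l' : Λ₁ × Λ₂, _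
      ≤ ((L₁ * L₂)⁻¹) ^ 2 * ∑ l : Λ₁ × Λ₂, ∑ l' : Λ₁ × Λ₂,
        ((if l.1 = l'.1 then if l.2 = l'.2 then b else 0 else 0) +
          (if l.1 = l'.1 then b₁ else 0) + (if l.2 = l'.2 then b₂ else 0)) := by
        refine mul_le_mul_of_nonneg_left (Finset.sum_le_sum fun l _ => Finset.sum_le_sum
          fun l' _ => ?_) (by positivity)
        have := cov_codebook_le hp hq ω hω hμ hμ1 hb0 hb₁0 hb₂0 hb hb₁ hb₂
          (e₁ l.1) (e₁ l'.1) (e₂ l.2) (e₂ l'.2)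
        simpa only [he₁.eq_iff, he₂.eq_iff] using this
    _ = ((L₁ * L₂)⁻¹) ^ 2 * (L₁ * L₂ * (b + L₂ * b₁ + L₁ * b₂)) := by
        congr 1
        have h1 : ∀ l : Λ₁ × Λ₂, ∑ l' : Λ₁ × Λ₂, (if l.1 = l'.1 then b₁ else 0) = L₂ * b₁ :=
          fun l => by rw [Fintype.sum_prod_type_right]; simp [← hL₂]
        simp only [Finset.sum_add_distrib, h1]
        simp only [Fintype.sum_prod_type]
        simp [← hL₁, ← hL₂]
        ring
    _ = _ := by
        field_simp

end Codebook

section Coding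

variable {U V Y : Type*} [Fintype U] [Fintype V] [Fintype Y]

/-- Codewords outside the transmitted position are independent of the channel output. -/
lemma packing_le {ι κ : Type*} [Fintype ι] [DecidableEq ι] [Fintype κ] [DecidableEq κ]
    {p : U → ℝ} {q : V → ℝ} (hp : IsPMF p) (hq : IsPMF q)
    {i : ι} (j : κ) {I : Finset ι} (hi : i ∉ I) (h : Y → U → V → ℝ) (hh : ∀ y u v, 0 ≤ h y u v)
    (hμ1 : (expect p fun u => expect q fun v => ∑ y, h y u v) ≤ 1)
    (A : U → Y → ℝ) {β : ℝ} (hβ0 : 0 ≤ β) (hβ : ∀ y, (expect p fun u => A u y) ≤ β) :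
    expect (iidPMF p) (fun c : ι → U => expect (iidPMF q) fun d : κ → V =>
      ∑ y, h y (c i) (d j) * ∑ i' ∈ I, A (c i') y) ≤ I.card * β := by
  have hQ := isPMF_iidPMF (ι := κ) hq
  have hrw : ∀ (c : ι → U) (d : κ → V), ∑ y, h y (c i) (d j) * ∑ i' ∈ I, A (c i') y =
      ∑ i' ∈ I, ∑ y, h y (c i) (d j) * A (c i') y := fun c d => by
    simp only [Finset.mul_sum]
    exact Finset.sum_comm
  simp only [hrw, expect_sum]
  rw [← nsmul_eq_mul]
  refine Finset.sum_le_card_nsmul _ _ _ fun i' hi' => ?_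
  have hne : i ≠ i' := fun h => hi (h ▸ hi')
  calc ∑ y, expect (iidPMF p) (fun c : ι → U => expect (iidPMF q) fun d : κ → V =>
          h y (c i) (d j) * A (c i') y)
      ≤ ∑ y, (expect p fun u => expect q (h y u)) * β := by
        refine Finset.sum_le_sum fun y _ => ?_
        rw [expect_comm]
        simp only [fun d : κ → V =>
          expect_iidPMF_mul hp hne (fun u => h y u (d j)) (fun u => A u y)]
        rw [expect_comm p q, ← expect_iidPMF_apply hq j fun v => expect p fun u => h y u v,
          ← expect_mul_const]
        exact expect_mono hQ fun d => mul_le_mul_of_nonneg_left (hβ y)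
          (expect_nonneg hp fun u => hh y u _)
    _ = (expect p fun u => expect q fun v => ∑ y, h y u v) * β := by
        simp only [expect_sum, Finset.sum_mul]
    _ ≤ β := mul_le_of_le_one_left hβ0 hμ1

lemma card_filter_fst_ne {Γ Λ : Type*} [Fintype Γ] [DecidableEq Γ] [Fintype Λ] (m : Γ) :
    (((Finset.univ.filter fun i : Γ × Λ => i.1 ≠ m).card : ℕ) : ℝ) =
      (Fintype.card Γ - 1) * Fintype.card Λ := by
  have : (Finset.univ.filter fun i : Γ × Λ => i.1 ≠ m) =
      (Finset.univ.erase m) ×ˢ (Finset.univ : Finset Λ) := by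
    ext i
    simp
  rw [this, Finset.card_product, Finset.card_erase_of_mem (Finset.mem_univ m),
    Finset.card_univ, Finset.card_univ, Nat.cast_mul, Nat.cast_sub, Nat.cast_one]
  exact Fintype.card_pos_iff.2 ⟨m⟩

/-- Random-coding bound for one message pair and one state: `h y u v` is the weight of choosing
the codewords `u, v` and observing `y`, and `a` is the error of the best channel input. -/
lemma expect_error_le {Γ₁ Γ₂ Λ₁ Λ₂ : Type*} [Fintype Γ₁] [DecidableEq Γ₁] [Fintype Γ₂]
    [DecidableEq Γ₂] [Fintype Λ₁] [DecidableEq Λ₁] [Fintype Λ₂] [DecidableEq Λ₂]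
    [Nonempty Λ₁] [Nonempty Λ₂] {p : U → ℝ} {q : V → ℝ} (hp : IsPMF p) (hq : IsPMF q)
    (m₁ : Γ₁) (m₂ : Γ₂) (a : (Γ₁ × Λ₁ → U) → (Γ₂ × Λ₂ → V) → ℝ)
    (ha0 : ∀ c d, 0 ≤ a c d) (ha1 : ∀ c d, a c d ≤ 1)
    (h : Y → U → V → ℝ) (hh : ∀ y u v, 0 ≤ h y u v)
    (e : (Γ₁ × Λ₁ → U) → (Γ₂ × Λ₂ → V) → Y → ℝ)
    (hae : ∀ c d u v, a c d * ∑ y, h y u v ≤ ∑ y, h y u v * e c d y)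
    (A₁ : U → Y → ℝ) (A₂ : V → Y → ℝ)
    (he : ∀ c d y l₁ l₂, e c d y ≤
      (1 - A₁ (c (m₁, l₁)) y) + (1 - A₂ (d (m₂, l₂)) y) +
      (∑ i with i.1 ≠ m₁, A₁ (c i) y) + ∑ j with j.1 ≠ m₂, A₂ (d j) y)
    {μ b b₁ b₂ β₁ β₂ η : ℝ} (hη : 0 < η)
    (hμ : μ = expect p fun u => expect q fun v => ∑ y, h y u v) (hμ1 : μ ≤ 1)
    (hb0 : 0 ≤ b) (hb₁0 : 0 ≤ b₁) (hb₂0 : 0 ≤ b₂)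
    (hb : ∀ u v, ∑ y, h y u v ≤ b) (hb₁ : ∀ u, expect q (fun v => ∑ y, h y u v) ≤ b₁)
    (hb₂ : ∀ v, expect p (fun u => ∑ y, h y u v) ≤ b₂)
    (hβ₁0 : 0 ≤ β₁) (hβ₁ : ∀ y, (expect p fun u => A₁ u y) ≤ β₁)
    (hβ₂0 : 0 ≤ β₂) (hβ₂ : ∀ y, (expect q fun v => A₂ v y) ≤ β₂) :
    expect (iidPMF p) (fun c => expect (iidPMF q) fun d => a c d) ≤
      (1 - μ) + η + η⁻¹ * (b / (Fintype.card Λ₁ * Fintype.card Λ₂) + b₁ / Fintype.card Λ₁ +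
        b₂ / Fintype.card Λ₂) +
      (expect p fun u => expect q fun v => ∑ y, h y u v * (1 - A₁ u y)) +
      (expect p fun u => expect q fun v => ∑ y, h y u v * (1 - A₂ v y)) +
      (Fintype.card Γ₁ - 1) * Fintype.card Λ₁ * β₁ +
      (Fintype.card Γ₂ - 1) * Fintype.card Λ₂ * β₂ := by
  have hP := isPMF_iidPMF (ι := Γ₁ × Λ₁) hp
  have hQ := isPMF_iidPMF (ι := Γ₂ × Λ₂) hq
  have hvar := var_codebook_le (e₁ := fun l : Λ₁ => (m₁, l)) (e₂ := fun l : Λ₂ => (m₂, l))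
    (fun _ _ h => (Prod.mk.inj h).2) (fun _ _ h => (Prod.mk.inj h).2) hp hq
    (fun u v => ∑ y, h y u v)
    (fun u v => Finset.sum_nonneg fun y _ => hh y u v) hμ hμ1 hb0 hb₁0 hb₂0 hb hb₁ hb₂
  set L : ℝ := (Fintype.card Λ₁ : ℝ) * Fintype.card Λ₂ with hL
  have hL0 : 0 < L := by
    have h1 : (0 : ℝ) < Fintype.card Λ₁ := by exact_mod_cast Fintype.card_pos
    have h2 : (0 : ℝ) < Fintype.card Λ₂ := by exact_mod_cast Fintype.card_pos
    positivity
  set D : (Γ₁ × Λ₁ → U) → (Γ₂ × Λ₂ → V) → Λ₁ × Λ₂ → ℝ := fun c d l =>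
    (∑ y, h y (c (m₁, l.1)) (d (m₂, l.2)) * (1 - A₁ (c (m₁, l.1)) y)) +
    (∑ y, h y (c (m₁, l.1)) (d (m₂, l.2)) * (1 - A₂ (d (m₂, l.2)) y)) +
    (∑ y, h y (c (m₁, l.1)) (d (m₂, l.2)) * ∑ i with i.1 ≠ m₁, A₁ (c i) y) +
    ∑ y, h y (c (m₁, l.1)) (d (m₂, l.2)) * ∑ j with j.1 ≠ m₂, A₂ (d j) y with hD
  have hpoint : ∀ c d, a c d ≤ L⁻¹ * (∑ l, D c d l) + ((1 - μ) + η) +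
      η⁻¹ * (μ - L⁻¹ * ∑ l : Λ₁ × Λ₂, ∑ y, h y (c (m₁, l.1)) (d (m₂, l.2))) ^ 2 := by
    intro c d
    set W := L⁻¹ * ∑ l : Λ₁ × Λ₂, ∑ y, h y (c (m₁, l.1)) (d (m₂, l.2)) with hW
    have h1 : a c d * W ≤ L⁻¹ * ∑ l, D c d l := by
      rw [hW, mul_left_comm, Finset.mul_sum]
      refine mul_le_mul_of_nonneg_left (Finset.sum_le_sum fun l _ => ?_) (by positivity)
      refine (hae c d _ _).trans ?_
      simp only [hD, ← Finset.sum_add_distrib, ← mul_add]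
      exact Finset.sum_le_sum fun y _ => mul_le_mul_of_nonneg_left (he c d y l.1 l.2) (hh _ _ _)
    have h2 : a c d * (1 - μ) ≤ 1 - μ := mul_le_of_le_one_left (by linarith) (ha1 c d)
    have h3 : a c d * (μ - W) ≤ |μ - W| :=
      (mul_le_mul_of_nonneg_left (le_abs_self _) (ha0 c d)).trans
        (mul_le_of_le_one_left (abs_nonneg _) (ha1 c d))
    have h4 : |μ - W| ≤ η + η⁻¹ * (μ - W) ^ 2 := by
      rw [← sq_abs (μ - W), ← sub_nonneg]
      have h5 : η + η⁻¹ * |μ - W| ^ 2 - |μ - W| =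
          η⁻¹ * ((|μ - W| - η) ^ 2 + |μ - W| * η) := by field_simp; ring
      rw [h5]
      positivity
    have h6 : a c d = a c d * W + a c d * (1 - μ) + a c d * (μ - W) := by ring
    linarith
  have hDl : ∀ l, expect (iidPMF p) (fun c => expect (iidPMF q) fun d => D c d l) ≤
      (expect p fun u => expect q fun v => ∑ y, h y u v * (1 - A₁ u y)) +
      (expect p fun u => expect q fun v => ∑ y, h y u v * (1 - A₂ v y)) +
      (Fintype.card Γ₁ - 1) * Fintype.card Λ₁ * β₁ +
      (Fintype.card Γ₂ - 1) * Fintype.card Λ₂ * β₂ := by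
    intro l
    simp only [hD, expect_add]
    refine add_le_add (add_le_add (add_le_add ?_ ?_) ?_) ?_
    · exact (expect_codebook_apply hp hq (m₁, l.1) (m₂, l.2)
        fun u v => ∑ y, h y u v * (1 - A₁ u y)).le
    · exact (expect_codebook_apply hp hq (m₁, l.1) (m₂, l.2)
        fun u v => ∑ y, h y u v * (1 - A₂ v y)).le
    · rw [← card_filter_fst_ne m₁]
      exact packing_le hp hq (m₂, l.2) (by simp) h hh (hμ ▸ hμ1) A₁ hβ₁0 hβ₁
    · rw [← card_filter_fst_ne m₂, expect_comm]
      refine packing_le hq hp (m₁, l.1) (by simp) (fun y v u => h y u v) (fun y v u => hh y u v)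
        ?_ A₂ hβ₂0 hβ₂
      rw [expect_comm]
      exact hμ ▸ hμ1
  have hmean : L⁻¹ * ∑ l, expect (iidPMF p) (fun c => expect (iidPMF q) fun d => D c d l) ≤
      (expect p fun u => expect q fun v => ∑ y, h y u v * (1 - A₁ u y)) +
      (expect p fun u => expect q fun v => ∑ y, h y u v * (1 - A₂ v y)) +
      (Fintype.card Γ₁ - 1) * Fintype.card Λ₁ * β₁ +
      (Fintype.card Γ₂ - 1) * Fintype.card Λ₂ * β₂ := by
    rw [inv_mul_le_iff₀ hL0]
    refine (Finset.sum_le_card_nsmul _ _ _ fun l _ => hDl l).trans_eq ?_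
    rw [nsmul_eq_mul, Finset.card_univ, Fintype.card_prod, Nat.cast_mul]
  have hall := expect_mono hP fun c => expect_mono hQ fun d => hpoint c d
  simp only [expect_add, expect_const_mul, expect_sum, expect_const hQ, expect_const hP] at hall
  have := mul_le_mul_of_nonneg_left hvar (inv_nonneg.2 hη.le)
  linarith

end Coding

section OneShot

open Classical in
/-- The decoder returning the unique message with a codeword related to the observation `z`. -/
noncomputable def decode {Γ Λ U Z : Type*} [Inhabited Γ] (A : U → Z → Prop) (c : Γ × Λ → U)
    (z : Z) : Γ :=
  if h : ∃ m, (∃ l, A (c (m, l)) z) ∧ ∀ m', (∃ l, A (c (m', l)) z) → m' = m then h.choose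
  else default

lemma decode_eq {Γ Λ U Z : Type*} [Inhabited Γ] {A : U → Z → Prop} {c : Γ × Λ → U} {z : Z}
    {m : Γ} {l : Λ} (h1 : A (c (m, l)) z) (h2 : ∀ i : Γ × Λ, i.1 ≠ m → ¬ A (c i) z) :
    decode A c z = m := by
  have h : ∃ m, (∃ l, A (c (m, l)) z) ∧ ∀ m', (∃ l, A (c (m', l)) z) → m' = m :=
    ⟨m, ⟨l, h1⟩, fun m' ⟨l', h'⟩ => by_contra fun hne => h2 (m', l') hne h'⟩
  rw [decode, dif_pos h]
  exact (h.choose_spec.2 m ⟨l, h1⟩).symm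

open Classical in
lemma one_le_of_decode_ne {Γ Λ U Z : Type*} [Inhabited Γ] [Fintype Γ] [DecidableEq Γ] [Fintype Λ]
    {A : U → Z → Prop} {c : Γ × Λ → U} {z : Z} {m : Γ} (h : decode A c z ≠ m) (l : Λ) :
    (1 : ℝ) ≤ (1 - if A (c (m, l)) z then 1 else 0) +
      ∑ i with i.1 ≠ m, if A (c i) z then 1 else 0 := by
  have hs : (0 : ℝ) ≤ ∑ i : Γ × Λ with i.1 ≠ m, if A (c i) z then 1 else 0 :=
    Finset.sum_nonneg fun i _ => by split_ifs <;> norm_num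
  by_cases h1 : A (c (m, l)) z
  · have : ∃ i : Γ × Λ, i.1 ≠ m ∧ A (c i) z := by
      by_contra! h2
      exact h (decode_eq h1 h2)
    obtain ⟨i, hi, hA⟩ := this
    have := Finset.single_le_sum (f := fun i : Γ × Λ => if A (c i) z then (1 : ℝ) else 0)
      (s := Finset.univ.filter fun i : Γ × Λ => i.1 ≠ m)
      (fun i _ => by split_ifs <;> norm_num) (by simpa using hi)
    simp only [hA, if_true] at this
    simp only [h1, if_true]
    linarith
  · simp only [h1, if_false]
    linarith

variable {S X U V Y Z₁ Z₂ : Type*} [Fintype S] [Fintype X] [Nonempty X] [Fintype U] [Fintype V]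
  [Fintype Y]

open Classical in
/-- One-shot achievability for a broadcast channel with states known at the encoder. -/
theorem exists_code_error_le {Ps : S → ℝ} (hPs : IsPMF Ps) {T : X → S → Y → ℝ}
    (hT : ∀ x s, IsPMF (T x s)) {p : U → ℝ} {q : V → ℝ} (hp : IsPMF p) (hq : IsPMF q)
    (w : S → U → V → X → ℝ) (hw : ∀ s u v x, 0 ≤ w s u v x)
    (hμ1 : ∀ s, (expect p fun u => expect q fun v => ∑ x, w s u v x) ≤ 1)
    {b b₁ b₂ β₁ β₂ η : ℝ} (hη : 0 < η)
    (hb0 : 0 ≤ b) (hb₁0 : 0 ≤ b₁) (hb₂0 : 0 ≤ b₂)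
    (hb : ∀ s u v, ∑ x, w s u v x ≤ b) (hb₁ : ∀ s u, expect q (fun v => ∑ x, w s u v x) ≤ b₁)
    (hb₂ : ∀ s v, expect p (fun u => ∑ x, w s u v x) ≤ b₂)
    (z₁ : S → Y → Z₁) (z₂ : S → Y → Z₂) (A₁ : U → Z₁ → Prop) (A₂ : V → Z₂ → Prop)
    (hβ₁0 : 0 ≤ β₁) (hβ₁ : ∀ z, (expect p fun u => if A₁ u z then 1 else 0) ≤ β₁)
    (hβ₂0 : 0 ≤ β₂) (hβ₂ : ∀ z, (expect q fun v => if A₂ v z then 1 else 0) ≤ β₂)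
    {M₁ M₂ L₁ L₂ : ℕ} (hM₁ : 0 < M₁) (hM₂ : 0 < M₂) (hL₁ : 0 < L₁) (hL₂ : 0 < L₂) :
    ∃ (f : Fin M₁ → Fin M₂ → S → X) (g₁ : Z₁ → Fin M₁) (g₂ : Z₂ → Fin M₂),
      ((M₁ : ℝ) * M₂)⁻¹ * ∑ m : Fin M₁ × Fin M₂, ∑ s, Ps s * ∑ y, T (f m.1 m.2 s) s y *
        (if g₁ (z₁ s y) = m.1 ∧ g₂ (z₂ s y) = m.2 then 0 else 1) ≤
      (expect Ps fun s => 1 - expect p fun u => expect q fun v => ∑ x, w s u v x) +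
      (expect Ps fun s => expect p fun u => expect q fun v =>
        ∑ y, (∑ x, w s u v x * T x s y) * (1 - if A₁ u (z₁ s y) then 1 else 0)) +
      (expect Ps fun s => expect p fun u => expect q fun v =>
        ∑ y, (∑ x, w s u v x * T x s y) * (1 - if A₂ v (z₂ s y) then 1 else 0)) +
      (η + η⁻¹ * (b / (L₁ * L₂) + b₁ / L₁ + b₂ / L₂) +
        (M₁ - 1) * L₁ * β₁ + (M₂ - 1) * L₂ * β₂) := by
  have : Inhabited (Fin M₁) := ⟨⟨0, hM₁⟩⟩
  have : Inhabited (Fin M₂) := ⟨⟨0, hM₂⟩⟩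
  have : Nonempty (Fin L₁) := ⟨⟨0, hL₁⟩⟩
  have : Nonempty (Fin L₂) := ⟨⟨0, hL₂⟩⟩
  have hP := isPMF_iidPMF (ι := Fin M₁ × Fin L₁) hp
  have hQ := isPMF_iidPMF (ι := Fin M₂ × Fin L₂) hq
  set err : Fin M₁ × Fin M₂ → S → (Fin M₁ × Fin L₁ → U) → (Fin M₂ × Fin L₂ → V) → Y → ℝ :=
    fun m s c d y =>
      if decode A₁ c (z₁ s y) = m.1 ∧ decode A₂ d (z₂ s y) = m.2 then 0 else 1 with herr
  have herr0 : ∀ m s c d y, 0 ≤ err m s c d y := fun m s c d y => by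
    simp only [herr]; split_ifs <;> norm_num
  have herr1 : ∀ m s c d y, err m s c d y ≤ 1 := fun m s c d y => by
    simp only [herr]; split_ifs <;> norm_num
  have hmin : ∀ m s c d, ∃ x, ∀ x', ∑ y, T x s y * err m s c d y ≤ ∑ y, T x' s y * err m s c d y :=
    fun m s c d => Finite.exists_min _
  choose F hF using hmin
  set a : Fin M₁ × Fin M₂ → S → (Fin M₁ × Fin L₁ → U) → (Fin M₂ × Fin L₂ → V) → ℝ :=
    fun m s c d => ∑ y, T (F m s c d) s y * err m s c d y with ha
  set C : ℝ := η + η⁻¹ * (b / (L₁ * L₂) + b₁ / L₁ + b₂ / L₂) +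
        (M₁ - 1) * L₁ * β₁ + (M₂ - 1) * L₂ * β₂ with hC
  set B : S → ℝ := fun s =>
    (1 - expect p fun u => expect q fun v => ∑ x, w s u v x) +
    (expect p fun u => expect q fun v =>
      ∑ y, (∑ x, w s u v x * T x s y) * (1 - if A₁ u (z₁ s y) then 1 else 0)) +
    (expect p fun u => expect q fun v =>
      ∑ y, (∑ x, w s u v x * T x s y) * (1 - if A₂ v (z₂ s y) then 1 else 0)) + C with hB
  have hsumT : ∀ s u v, ∑ y, ∑ x, w s u v x * T x s y = ∑ x, w s u v x := by
    intro s u v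
    rw [Finset.sum_comm]
    refine Finset.sum_congr rfl fun x _ => ?_
    rw [← Finset.mul_sum, (hT x s).2, mul_one]
  have hstate : ∀ m s, expect (iidPMF p) (fun c => expect (iidPMF q) fun d => a m s c d) ≤ B s := by
    intro m s
    have := expect_error_le (Λ₁ := Fin L₁) (Λ₂ := Fin L₂) hp hq m.1 m.2 (a m s)
      (fun c d => Finset.sum_nonneg fun y _ => mul_nonneg ((hT _ s).1 y) (herr0 m s c d y))
      (fun c d => (Finset.sum_le_sum fun y _ =>
        mul_le_of_le_one_right ((hT _ s).1 y) (herr1 m s c d y)).trans_eq (hT _ s).2)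
      (fun y u v => ∑ x, w s u v x * T x s y)
      (fun y u v => Finset.sum_nonneg fun x _ => mul_nonneg (hw s u v x) ((hT x s).1 y))
      (err m s) (by
        intro c d u v
        rw [hsumT, Finset.mul_sum]
        simp only [Finset.sum_mul]
        rw [Finset.sum_comm]
        refine Finset.sum_le_sum fun x _ => ?_
        simp only [mul_assoc, ← Finset.mul_sum]
        rw [mul_comm]
        exact mul_le_mul_of_nonneg_left (hF m s c d x) (hw s u v x))
      (fun u y => if A₁ u (z₁ s y) then 1 else 0) (fun v y => if A₂ v (z₂ s y) then 1 else 0)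
      (by
        intro c d y l₁ l₂
        have n1 : (0 : ℝ) ≤ 1 - if A₁ (c (m.1, l₁)) (z₁ s y) then 1 else 0 := by
          split_ifs <;> norm_num
        have n2 : (0 : ℝ) ≤ 1 - if A₂ (d (m.2, l₂)) (z₂ s y) then 1 else 0 := by
          split_ifs <;> norm_num
        have n3 : (0 : ℝ) ≤ ∑ i : Fin M₁ × Fin L₁ with i.1 ≠ m.1,
            if A₁ (c i) (z₁ s y) then 1 else 0 :=
          Finset.sum_nonneg fun i _ => by split_ifs <;> norm_num
        have n4 : (0 : ℝ) ≤ ∑ i : Fin M₂ × Fin L₂ with i.1 ≠ m.2,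
            if A₂ (d i) (z₂ s y) then 1 else 0 :=
          Finset.sum_nonneg fun i _ => by split_ifs <;> norm_num
        simp only [herr]
        by_cases h : decode A₁ c (z₁ s y) = m.1 ∧ decode A₂ d (z₂ s y) = m.2
        · rw [if_pos h]
          linarith
        · rw [if_neg h]
          rcases not_and_or.1 h with h | h
          · linarith [one_le_of_decode_ne h l₁]
          · linarith [one_le_of_decode_ne h l₂])
      hη (μ := expect p fun u => expect q fun v => ∑ x, w s u v x)
      (by simp only [hsumT]) (hμ1 s) hb0 hb₁0 hb₂0
      (fun u v => (hsumT s u v).trans_le (hb s u v))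
      (fun u => by simp only [hsumT]; exact hb₁ s u)
      (fun v => by simp only [hsumT]; exact hb₂ s v)
      hβ₁0 (fun y => hβ₁ _) hβ₂0 (fun y => hβ₂ _)
    simp only [Fintype.card_fin] at this
    simp only [hB, hC]
    linarith
  obtain ⟨c, hc⟩ := exists_le_expect hP (F := fun c => expect (iidPMF q) fun d =>
    ((M₁ : ℝ) * M₂)⁻¹ * ∑ m : Fin M₁ × Fin M₂, ∑ s, Ps s * a m s c d)
  obtain ⟨d, hd⟩ := exists_le_expect hQ (F := fun d =>
    ((M₁ : ℝ) * M₂)⁻¹ * ∑ m : Fin M₁ × Fin M₂, ∑ s, Ps s * a m s c d)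
  have htot : expect (iidPMF p) (fun c => expect (iidPMF q) fun d =>
      ((M₁ : ℝ) * M₂)⁻¹ * ∑ m : Fin M₁ × Fin M₂, ∑ s, Ps s * a m s c d) ≤ expect Ps B := by
    simp only [expect_const_mul, expect_sum]
    have hM : (0 : ℝ) < (M₁ : ℝ) * M₂ := by positivity
    rw [inv_mul_le_iff₀ hM]
    have hone : ∀ m, ∑ s, Ps s * expect (iidPMF p)
        (fun c => expect (iidPMF q) fun d => a m s c d) ≤ expect Ps B :=
      fun m => expect_mono hPs (hstate m)
    refine (Finset.sum_le_card_nsmul _ _ _ fun m _ => hone m).trans_eq ?_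
    rw [nsmul_eq_mul, Finset.card_univ, Fintype.card_prod, Fintype.card_fin, Fintype.card_fin,
      Nat.cast_mul]
  refine ⟨fun m₁ m₂ s => F (m₁, m₂) s c d, decode A₁ c, decode A₂ d,
    ((hd.trans hc).trans htot).trans_eq ?_⟩
  simp only [hB, expect_add, expect_const hPs]

end OneShot

section Law

variable {Ω α β : Type*} [Fintype Ω]

lemma expect_push [Fintype α] (μ : Ω → ℝ) (X : Ω → α) (h : α → ℝ) :
    expect (push μ X) h = expect μ fun ω => h (X ω) := by
  classical
  simp only [expect, push, Finset.sum_mul]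
  rw [Finset.sum_comm]
  refine Finset.sum_congr rfl fun ω _ => ?_
  simp [ite_mul]

lemma push_nonneg {μ : Ω → ℝ} (hμ : ∀ ω, 0 ≤ μ ω) (X : Ω → α) (a : α) : 0 ≤ push μ X a :=
  Finset.sum_nonneg fun ω _ => by
    split_ifs
    exacts [hμ ω, le_rfl]

lemma le_push {μ : Ω → ℝ} (hμ : ∀ ω, 0 ≤ μ ω) (X : Ω → α) (ω : Ω) : μ ω ≤ push μ X (X ω) := by
  classical
  have := Finset.single_le_sum (f := fun ω' => if X ω' = X ω then μ ω' else 0)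
    (s := Finset.univ) (fun ω' _ => by
      split_ifs
      exacts [hμ ω', le_rfl]) (Finset.mem_univ ω)
  simpa [push] using this

lemma sum_push [Fintype α] (μ : Ω → ℝ) (X : Ω → α) : ∑ a, push μ X a = ∑ ω, μ ω := by
  simpa [expect] using expect_push μ X fun _ => 1

lemma isPMF_push [Fintype α] {μ : Ω → ℝ} (hμ : IsPMF μ) (X : Ω → α) : IsPMF (push μ X) :=
  ⟨push_nonneg hμ.1 X, (sum_push μ X).trans hμ.2⟩

lemma sum_push_prod_left [Fintype α] (μ : Ω → ℝ) (X : Ω → α) (Y : Ω → β) (b : β) :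
    ∑ a, push μ (fun ω => (X ω, Y ω)) (a, b) = push μ Y b := by
  classical
  simp only [push]
  rw [Finset.sum_comm]
  refine Finset.sum_congr rfl fun ω _ => ?_
  by_cases h : Y ω = b <;> simp [h]

lemma expect_log_push [Fintype α] (μ : Ω → ℝ) (X : Ω → α) :
    expect μ (fun ω => Real.log (push μ X (X ω))) = -entRV μ X := by
  rw [← expect_push μ X fun a => Real.log (push μ X a)]
  simp [expect, entRV, ent, Real.negMulLog]

/-- The information density of `X` and `Y`. -/
noncomputable def infoDensity (μ : Ω → ℝ) (X : Ω → α) (Y : Ω → β) (ω : Ω) : ℝ :=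
  Real.log (push μ (fun ω => (X ω, Y ω)) (X ω, Y ω)) - Real.log (push μ X (X ω)) -
    Real.log (push μ Y (Y ω))

variable [Fintype α] [Fintype β]

lemma expect_infoDensity (μ : Ω → ℝ) (X : Ω → α) (Y : Ω → β) :
    expect μ (infoDensity μ X Y) = miRV μ X Y := by
  unfold infoDensity
  rw [expect_sub, expect_sub, expect_log_push μ X, expect_log_push μ Y,
    expect_log_push μ fun ω => (X ω, Y ω), miRV]
  ring

lemma miRV_nonneg {μ : Ω → ℝ} (hμ : IsPMF μ) (X : Ω → α) (Y : Ω → β) : 0 ≤ miRV μ X Y := by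
  rw [← expect_infoDensity]
  set pXY := push μ fun ω => (X ω, Y ω) with hpXY
  set r : α × β → ℝ := fun z => push μ X z.1 * push μ Y z.2 / pXY z with hr
  have h1 : expect pXY r ≤ 1 := by
    have hle : expect pXY r ≤ ∑ z : α × β, push μ X z.1 * push μ Y z.2 := by
      refine Finset.sum_le_sum fun z _ => ?_
      simp only [hr]
      rcases eq_or_ne (pXY z) 0 with h0 | h0
      · rw [h0, zero_mul]
        exact mul_nonneg (push_nonneg hμ.1 _ _) (push_nonneg hμ.1 _ _)
      · rw [mul_div_cancel₀ _ h0]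
    refine hle.trans_eq ?_
    rw [Fintype.sum_prod_type]
    simp only [← Finset.mul_sum, (isPMF_push hμ Y).2, mul_one, (isPMF_push hμ X).2]
  rw [hpXY, expect_push] at h1
  have h2 : expect μ (fun ω => 1 - r (X ω, Y ω)) ≤ expect μ (infoDensity μ X Y) := by
    refine Finset.sum_le_sum fun ω _ => ?_
    rcases (hμ.1 ω).eq_or_lt with h0 | h0
    · simp [← h0]
    refine mul_le_mul_of_nonneg_left ?_ h0.le
    have hx := h0.trans_le (le_push hμ.1 X ω)
    have hy := h0.trans_le (le_push hμ.1 Y ω)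
    have hxy : 0 < pXY (X ω, Y ω) := h0.trans_le (le_push hμ.1 (fun ω => (X ω, Y ω)) ω)
    have hpos : 0 < r (X ω, Y ω) := by
      simp only [hr]
      positivity
    have hlog := Real.log_le_sub_one_of_pos hpos
    simp only [hr] at hlog ⊢
    rw [Real.log_div (by positivity) hxy.ne', Real.log_mul hx.ne' hy.ne'] at hlog
    simp only [infoDensity, ← hpXY]
    linarith
  rw [expect_sub, expect_const hμ] at h2
  linarith

lemma expect_sq_sum_iidPMF {μ : Ω → ℝ} (hμ : IsPMF μ) {ψ : Ω → ℝ} (hψ : expect μ ψ = 0) (n : ℕ) :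
    expect (iidPMF μ) (fun ω : Fin n → Ω => (∑ i, ψ (ω i)) ^ 2) =
      n * expect μ fun ω => ψ ω ^ 2 := by
  simp only [sq, Finset.sum_mul_sum, expect_sum]
  have h : ∀ i j : Fin n, expect (iidPMF μ) (fun ω : Fin n → Ω => ψ (ω i) * ψ (ω j)) =
      if i = j then expect μ (fun ω => ψ ω * ψ ω) else 0 := by
    intro i j
    split_ifs with hij
    · subst hij
      exact expect_iidPMF_apply hμ i fun ω => ψ ω * ψ ω
    · rw [expect_iidPMF_mul hμ hij, hψ, zero_mul]
  simp [h]

lemma expect_deviation_le {μ : Ω → ℝ} (hμ : IsPMF μ) (φ : Ω → ℝ) {δ : ℝ} (hδ : 0 < δ) {n : ℕ}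
    (hn : 0 < n) :
    expect (iidPMF μ) (fun ω : Fin n → Ω =>
      if |∑ i, φ (ω i) - n * expect μ φ| < n * δ then 0 else 1) ≤
      expect μ (fun ω => (φ ω - expect μ φ) ^ 2) / δ ^ 2 / n := by
  have hn' : (0 : ℝ) < n := by exact_mod_cast hn
  have hψ : expect μ (fun ω => φ ω - expect μ φ) = 0 := by
    rw [expect_sub, expect_const hμ, sub_self]
  have hpt : ∀ ω : Fin n → Ω, (if |∑ i, φ (ω i) - n * expect μ φ| < n * δ then (0 : ℝ) else 1) ≤
      (n * δ)⁻¹ ^ 2 * (∑ i, (φ (ω i) - expect μ φ)) ^ 2 := by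
    intro ω
    rw [Finset.sum_sub_distrib, Finset.sum_const, Finset.card_univ, Fintype.card_fin, nsmul_eq_mul]
    split_ifs with h
    · positivity
    · rw [inv_pow, inv_mul_eq_div, one_le_div (by positivity), ← sq_abs (∑ i, φ (ω i) - _)]
      exact pow_le_pow_left₀ (by positivity) (not_lt.1 h) 2
  refine (expect_mono (isPMF_iidPMF hμ) hpt).trans_eq ?_
  rw [expect_const_mul, expect_sq_sum_iidPMF hμ hψ]
  field_simp

/-- Weak joint typicality of two sequences for the joint law of `X` and `Y`. -/
def JointlyTypical (μ : Ω → ℝ) (X : Ω → α) (Y : Ω → β) (δ : ℝ) {n : ℕ} (a : Fin n → α)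
    (b : Fin n → β) : Prop :=
  0 < ∏ i, push μ (fun ω => (X ω, Y ω)) (a i, b i) ∧
  ∏ i, push μ (fun ω => (X ω, Y ω)) (a i, b i) ≤
    Real.exp (n * (miRV μ X Y + δ)) * (iidPMF (push μ X) a * iidPMF (push μ Y) b) ∧
  Real.exp (n * (miRV μ X Y - δ)) * (iidPMF (push μ X) a * iidPMF (push μ Y) b) ≤
    ∏ i, push μ (fun ω => (X ω, Y ω)) (a i, b i)

lemma JointlyTypical.pos {μ : Ω → ℝ} (hμ : IsPMF μ) {X : Ω → α} {Y : Ω → β} {δ : ℝ} {n : ℕ}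
    {a : Fin n → α} {b : Fin n → β} (h : JointlyTypical μ X Y δ a b) :
    0 < iidPMF (push μ X) a ∧ 0 < iidPMF (push μ Y) b := by
  have hx := (isPMF_iidPMF (ι := Fin n) (isPMF_push hμ X)).1 a
  have hy := (isPMF_iidPMF (ι := Fin n) (isPMF_push hμ Y)).1 b
  have h1 := h.1.trans_le h.2.1
  have h2 := (pos_iff_pos_of_mul_pos h1).1 (Real.exp_pos _)
  exact ⟨hx.lt_of_ne fun h0 => by simp [← h0] at h2, hy.lt_of_ne fun h0 => by simp [← h0] at h2⟩

open Classical in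
lemma expect_not_jointlyTypical_le {μ : Ω → ℝ} (hμ : IsPMF μ) (X : Ω → α) (Y : Ω → β) {δ : ℝ}
    (hδ : 0 < δ) : ∃ K : ℝ, 0 ≤ K ∧ ∀ n : ℕ, 0 < n →
      expect (iidPMF μ) (fun ω : Fin n → Ω =>
        if JointlyTypical μ X Y δ (fun i => X (ω i)) (fun i => Y (ω i)) then 0 else 1) ≤ K / n := by
  refine ⟨expect μ (fun ω => (infoDensity μ X Y ω - expect μ (infoDensity μ X Y)) ^ 2) / δ ^ 2,
    div_nonneg (expect_nonneg hμ fun ω => sq_nonneg _) (sq_nonneg _), fun n hn => ?_⟩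
  refine le_trans (Finset.sum_le_sum fun ω _ => ?_)
    (expect_deviation_le hμ (infoDensity μ X Y) hδ hn)
  have hq := (isPMF_iidPMF (ι := Fin n) hμ).1 ω
  rcases hq.eq_or_lt with h0 | h0
  · rw [← h0, zero_mul, zero_mul]
  refine mul_le_mul_of_nonneg_left ?_ h0.le
  beta_reduce
  have hω : ∀ i, 0 < μ (ω i) := fun i =>
    (hμ.1 _).lt_of_ne' (Finset.prod_ne_zero_iff.1 h0.ne' i (Finset.mem_univ i))
  by_cases hd : |∑ i, infoDensity μ X Y (ω i) - n * expect μ (infoDensity μ X Y)| < n * δ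
  swap
  · rw [if_neg hd]
    split_ifs <;> norm_num
  rw [if_pos hd, if_pos]
  rw [expect_infoDensity, abs_lt] at hd
  have hx : ∀ i, 0 < push μ X (X (ω i)) := fun i => (hω i).trans_le (le_push hμ.1 X _)
  have hy : ∀ i, 0 < push μ Y (Y (ω i)) := fun i => (hω i).trans_le (le_push hμ.1 Y _)
  have hxy : ∀ i, 0 < push μ (fun ω => (X ω, Y ω)) (X (ω i), Y (ω i)) := fun i =>
    (hω i).trans_le (le_push hμ.1 (fun ω => (X ω, Y ω)) _)
  have hX : 0 < iidPMF (push μ X) fun i => X (ω i) := Finset.prod_pos fun i _ => hx i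
  have hY : 0 < iidPMF (push μ Y) fun i => Y (ω i) := Finset.prod_pos fun i _ => hy i
  have hXY : ∏ i, push μ (fun ω => (X ω, Y ω)) (X (ω i), Y (ω i)) =
      Real.exp (∑ i, infoDensity μ X Y (ω i)) *
        (iidPMF (push μ X) (fun i => X (ω i)) * iidPMF (push μ Y) fun i => Y (ω i)) := by
    rw [Real.exp_sum, iidPMF, iidPMF, ← Finset.prod_mul_distrib, ← Finset.prod_mul_distrib]
    refine Finset.prod_congr rfl fun i _ => ?_
    rw [infoDensity, Real.exp_sub, Real.exp_sub, Real.exp_log (hx i), Real.exp_log (hy i),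
      Real.exp_log (hxy i)]
    have := (hx i).ne'
    have := (hy i).ne'
    field_simp
  refine ⟨Finset.prod_pos fun i _ => hxy i, ?_, ?_⟩ <;> rw [hXY] <;>
    refine mul_le_mul_of_nonneg_right (Real.exp_le_exp.2 ?_) (by positivity) <;> linarith

end Law

section Packing

variable {Ω α β : Type*} [Fintype Ω] [Fintype α] [Fintype β]

open Classical in
lemma expect_jointlyTypical_le {μ : Ω → ℝ} (hμ : IsPMF μ) (X : Ω → α) (Y : Ω → β) (δ : ℝ) {n : ℕ}
    (b : Fin n → β) :
    (expect (iidPMF (push μ X)) fun a => if JointlyTypical μ X Y δ a b then 1 else 0) ≤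
      Real.exp (-(n * (miRV μ X Y - δ))) := by
  rcases ((isPMF_iidPMF (ι := Fin n) (isPMF_push hμ Y)).1 b).eq_or_lt with h0 | h0
  · have : ∀ a, ¬ JointlyTypical μ X Y δ a b := fun a h => (h.pos hμ).2.ne h0
    simp only [this, if_false]
    rw [expect_const (isPMF_iidPMF (isPMF_push hμ X))]
    positivity
  · have hpt : ∀ a : Fin n → α,
        iidPMF (push μ X) a * (if JointlyTypical μ X Y δ a b then 1 else 0) ≤
        Real.exp (-(n * (miRV μ X Y - δ))) * (iidPMF (push μ Y) b)⁻¹ *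
          ∏ i, push μ (fun ω => (X ω, Y ω)) (a i, b i) := by
      intro a
      split_ifs with h
      · rw [mul_one, Real.exp_neg, ← mul_inv, inv_mul_eq_div, le_div_iff₀ (by positivity)]
        refine le_of_eq_of_le ?_ h.2.2
        ring
      · rw [mul_zero]
        exact mul_nonneg (by positivity) (Finset.prod_nonneg fun i _ => push_nonneg hμ.1 _ _)
    refine (Finset.sum_le_sum fun a _ => hpt a).trans_eq ?_
    rw [← Finset.mul_sum, sum_pi_prod fun i a => push μ (fun ω => (X ω, Y ω)) (a, b i)]
    simp only [sum_push_prod_left]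
    rw [← iidPMF, mul_assoc, inv_mul_cancel₀ h0.ne', mul_one]

end Packing

section StateLaw

set_option linter.unusedSectionVars false

variable {S X U V Y Z₁ Z₂ : Type*} [Fintype S] [Fintype X] [Fintype U] [Fintype V] [Fintype Y]

/-- The law of `((u, v, x), s, y)` for a state `s ∼ Ps`, a choice `(u, v, x) ∼ Pc s` and a channel
output `y ∼ T x s`. -/
def stateLaw (Ps : S → ℝ) (Pc : S → U × V × X → ℝ) (T : X → S → Y → ℝ) :
    (U × V × X) × S × Y → ℝ :=
  fun q => Ps q.2.1 * Pc q.2.1 q.1 * T q.1.2.2 q.2.1 q.2.2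

lemma sum_pi_mk {ι α β : Type*} [Fintype ι] [DecidableEq ι] [Fintype α] [Fintype β]
    (F : (ι → α × β) → ℝ) : ∑ c, F c = ∑ a : ι → α, ∑ b : ι → β, F fun i => (a i, b i) := by
  rw [← Fintype.sum_prod_type',
    ← (Equiv.arrowProdEquivProdArrow ι (fun _ => α) fun _ => β).symm.sum_comp]
  rfl

/-- The blockwise choice kernel. -/
noncomputable def choiceSeq (Pc : S → U × V × X → ℝ) {n : ℕ} (s : Fin n → S) (u : Fin n → U)
    (v : Fin n → V) (x : Fin n → X) : ℝ :=
  ∏ i, Pc (s i) (u i, v i, x i)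

/-- The blockwise channel. -/
noncomputable def chanSeq (T : X → S → Y → ℝ) {n : ℕ} (x : Fin n → X) (s : Fin n → S)
    (y : Fin n → Y) : ℝ :=
  ∏ i, T (x i) (s i) (y i)

variable {Ps : S → ℝ} {Pc : S → U × V × X → ℝ} {T : X → S → Y → ℝ}

lemma expect_iidPMF_stateLaw {n : ℕ} (F : (Fin n → (U × V × X) × S × Y) → ℝ) :
    expect (iidPMF (stateLaw Ps Pc T)) F = ∑ s, iidPMF Ps s * ∑ u, ∑ v, ∑ x,
      choiceSeq Pc s u v x * ∑ y, chanSeq T x s y * F fun i => ((u i, v i, x i), s i, y i) := by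
  simp only [expect, sum_pi_mk, Finset.mul_sum, iidPMF, stateLaw, choiceSeq, chanSeq,
    Finset.prod_mul_distrib]
  rw [Finset.sum_congr rfl fun u _ => Finset.sum_congr rfl fun v _ => Finset.sum_comm,
    Finset.sum_congr rfl fun u _ => Finset.sum_comm, Finset.sum_comm]
  simp only [mul_assoc]

lemma isPMF_chanSeq (hT : ∀ x s, IsPMF (T x s)) {n : ℕ} (x : Fin n → X) (s : Fin n → S) :
    IsPMF (chanSeq T x s) :=
  ⟨fun _ => Finset.prod_nonneg fun _ _ => (hT _ _).1 _, by
    simp only [chanSeq]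
    rw [sum_pi_prod fun i y => T (x i) (s i) y]
    simp [(hT _ _).2]⟩

lemma choiceSeq_nonneg (hPc : ∀ s, IsPMF (Pc s)) {n : ℕ} (s : Fin n → S) (u : Fin n → U)
    (v : Fin n → V) (x : Fin n → X) : 0 ≤ choiceSeq Pc s u v x :=
  Finset.prod_nonneg fun _ _ => (hPc _).1 _

lemma sum_choiceSeq {n : ℕ} (s : Fin n → S) (u : Fin n → U) (v : Fin n → V) :
    ∑ x, choiceSeq Pc s u v x = ∏ i, ∑ x, Pc (s i) (u i, v i, x) :=
  sum_pi_prod fun i x => Pc (s i) (u i, v i, x)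

lemma sum_sum_choiceSeq_right {n : ℕ} (s : Fin n → S) (u : Fin n → U) :
    ∑ v, ∑ x, choiceSeq Pc s u v x = ∏ i, ∑ v, ∑ x, Pc (s i) (u i, v, x) := by
  simp only [sum_choiceSeq]
  exact sum_pi_prod fun i v => ∑ x, Pc (s i) (u i, v, x)

lemma sum_sum_choiceSeq_left {n : ℕ} (s : Fin n → S) (v : Fin n → V) :
    ∑ u, ∑ x, choiceSeq Pc s u v x = ∏ i, ∑ u, ∑ x, Pc (s i) (u, v i, x) := by
  simp only [sum_choiceSeq]
  exact sum_pi_prod fun i u => ∑ x, Pc (s i) (u, v i, x)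

lemma sum_sum_sum_choiceSeq (hPc : ∀ s, IsPMF (Pc s)) {n : ℕ} (s : Fin n → S) :
    ∑ u, ∑ v, ∑ x, choiceSeq Pc s u v x = 1 := by
  simp only [sum_sum_choiceSeq_right]
  rw [sum_pi_prod fun i u => ∑ v, ∑ x, Pc (s i) (u, v, x)]
  refine Finset.prod_eq_one fun i _ => ?_
  rw [← (hPc (s i)).2, Fintype.sum_prod_type]
  simp only [Fintype.sum_prod_type]

lemma isPMF_stateLaw (hPs : IsPMF Ps) (hPc : ∀ s, IsPMF (Pc s)) (hT : ∀ x s, IsPMF (T x s)) :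
    IsPMF (stateLaw Ps Pc T) := by
  refine ⟨fun q => mul_nonneg (mul_nonneg (hPs.1 _) ((hPc _).1 _)) ((hT _ _).1 _), ?_⟩
  rw [Fintype.sum_prod_type, Finset.sum_comm, Fintype.sum_prod_type]
  simp only [stateLaw]
  rw [Finset.sum_congr rfl fun s _ => Finset.sum_comm]
  simp only [← Finset.mul_sum, (hT _ _).2, mul_one, (hPc _).2, hPs.2]

open Classical in
lemma push_stateLaw (hT : ∀ x s, IsPMF (T x s)) {α : Type*} (h : U × V × X → S → α) (a : α) :
    push (stateLaw Ps Pc T) (fun q => h q.1 q.2.1) a =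
      ∑ u, ∑ v, ∑ x, ∑ s, if h (u, v, x) s = a then Ps s * Pc s (u, v, x) else 0 := by
  simp only [push, stateLaw, Fintype.sum_prod_type]
  refine Finset.sum_congr rfl fun u _ => Finset.sum_congr rfl fun v _ =>
    Finset.sum_congr rfl fun x _ => Finset.sum_congr rfl fun s _ => ?_
  split_ifs
  · rw [← Finset.mul_sum, (hT _ _).2, mul_one]
  · simp

lemma push_state (hPc : ∀ s, IsPMF (Pc s)) (hT : ∀ x s, IsPMF (T x s)) :
    push (stateLaw Ps Pc T) (fun q => q.2.1) = Ps := by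
  classical
  funext s
  rw [push_stateLaw hT fun _ s => s]
  simp only [Finset.sum_ite_eq', Finset.mem_univ, if_true, ← Finset.mul_sum]
  have := (hPc s).2
  simp only [Fintype.sum_prod_type] at this
  rw [this, mul_one]

lemma push_left_state (hT : ∀ x s, IsPMF (T x s)) (u : U) (s : S) :
    push (stateLaw Ps Pc T) (fun q => (q.1.1, q.2.1)) (u, s) =
      Ps s * ∑ v, ∑ x, Pc s (u, v, x) := by
  classical
  rw [push_stateLaw hT fun c s => (c.1, s)]
  simp [ite_and, Finset.mul_sum, Finset.sum_ite_irrel]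

lemma push_right_state (hT : ∀ x s, IsPMF (T x s)) (v : V) (s : S) :
    push (stateLaw Ps Pc T) (fun q => (q.1.2.1, q.2.1)) (v, s) =
      Ps s * ∑ u, ∑ x, Pc s (u, v, x) := by
  classical
  rw [push_stateLaw hT fun c s => (c.2.1, s)]
  simp [ite_and, Finset.mul_sum, Finset.sum_ite_irrel]

lemma push_pair_state (hT : ∀ x s, IsPMF (T x s)) (u : U) (v : V) (s : S) :
    push (stateLaw Ps Pc T) (fun q => ((q.1.1, q.1.2.1), q.2.1)) ((u, v), s) =
      Ps s * ∑ x, Pc s (u, v, x) := by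
  classical
  rw [push_stateLaw hT fun c s => ((c.1, c.2.1), s)]
  simp [ite_and, Finset.mul_sum, Finset.sum_ite_irrel]

end StateLaw

section Block

set_option linter.unusedSectionVars false

variable {S X U V Y Z₁ Z₂ : Type*} [Fintype S] [Fintype X] [Fintype U] [Fintype V] [Fintype Y]
  {Ps : S → ℝ} {Pc : S → U × V × X → ℝ} {T : X → S → Y → ℝ}

lemma ite_and_le (P Q R W : Prop) [Decidable P] [Decidable Q] [Decidable R] [Decidable W]
    [Decidable (P ∧ Q ∧ R ∧ W)] : (if P ∧ Q ∧ R ∧ W then (0 : ℝ) else 1) ≤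
      (if P then 0 else 1) + (if Q then 0 else 1) + (if R then 0 else 1) + if W then 0 else 1 := by
  by_cases hP : P <;> by_cases hQ : Q <;> by_cases hR : R <;> by_cases hW : W <;>
    (simp [hP, hQ, hR, hW]; try norm_num)

/-- Codewords that are jointly typical with each other and with the state sequence. -/
def IsGoodChoice (μ : (U × V × X) × S × Y → ℝ) (δ : ℝ) {n : ℕ} (s : Fin n → S) (u : Fin n → U)
    (v : Fin n → V) : Prop :=
  JointlyTypical μ (fun q => q.1.1) (fun q => q.2.1) δ u s ∧
  JointlyTypical μ (fun q => q.1.2.1) (fun q => q.2.1) δ v s ∧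
  JointlyTypical μ (fun q => q.1.1) (fun q => q.1.2.1) δ u v ∧
  JointlyTypical μ (fun q => (q.1.1, q.1.2.1)) (fun q => q.2.1) δ (fun i => (u i, v i)) s

open Classical in
/-- The ratio of the choice kernel to the product of the codeword laws, restricted to good
choices. -/
noncomputable def choiceWeight (Ps : S → ℝ) (Pc : S → U × V × X → ℝ) (T : X → S → Y → ℝ) (δ : ℝ)
    {n : ℕ} (s : Fin n → S) (u : Fin n → U) (v : Fin n → V) (x : Fin n → X) : ℝ :=
  if IsGoodChoice (stateLaw Ps Pc T) δ s u v then
    choiceSeq Pc s u v x / (iidPMF (push (stateLaw Ps Pc T) fun q => q.1.1) u *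
      iidPMF (push (stateLaw Ps Pc T) fun q => q.1.2.1) v)
  else 0

lemma choiceWeight_nonneg (hPs : IsPMF Ps) (hPc : ∀ s, IsPMF (Pc s))
    (hT : ∀ x s, IsPMF (T x s)) (δ : ℝ) {n : ℕ} (s : Fin n → S) (u : Fin n → U) (v : Fin n → V)
    (x : Fin n → X) : 0 ≤ choiceWeight Ps Pc T δ s u v x := by
  have hQ := isPMF_stateLaw hPs hPc hT
  unfold choiceWeight
  split_ifs
  · exact div_nonneg (choiceSeq_nonneg hPc s u v x)
      (mul_nonneg ((isPMF_iidPMF (isPMF_push hQ _)).1 _) ((isPMF_iidPMF (isPMF_push hQ _)).1 _))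
  · exact le_rfl

open Classical in
lemma mul_choiceWeight (hPs : IsPMF Ps) (hPc : ∀ s, IsPMF (Pc s))
    (hT : ∀ x s, IsPMF (T x s)) (δ : ℝ) {n : ℕ} (s : Fin n → S) (u : Fin n → U) (v : Fin n → V)
    (x : Fin n → X) :
    iidPMF (push (stateLaw Ps Pc T) fun q => q.1.1) u *
      (iidPMF (push (stateLaw Ps Pc T) fun q => q.1.2.1) v * choiceWeight Ps Pc T δ s u v x) =
    if IsGoodChoice (stateLaw Ps Pc T) δ s u v then choiceSeq Pc s u v x else 0 := by
  have hQ := isPMF_stateLaw hPs hPc hT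
  unfold choiceWeight
  split_ifs with h
  · have h1 := (h.1.pos hQ).1.ne'
    have h2 := (h.2.1.pos hQ).1.ne'
    field_simp
  · simp

open Classical in
lemma expect_expect_choiceWeight (hPs : IsPMF Ps) (hPc : ∀ s, IsPMF (Pc s))
    (hT : ∀ x s, IsPMF (T x s)) (δ : ℝ) {n : ℕ} (s : Fin n → S)
    (F : (Fin n → U) → (Fin n → V) → (Fin n → X) → ℝ) :
    (expect (iidPMF (push (stateLaw Ps Pc T) fun q => q.1.1)) fun u =>
      expect (iidPMF (push (stateLaw Ps Pc T) fun q => q.1.2.1)) fun v =>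
        ∑ x, choiceWeight Ps Pc T δ s u v x * F u v x) =
    ∑ u, ∑ v, ∑ x, (if IsGoodChoice (stateLaw Ps Pc T) δ s u v then choiceSeq Pc s u v x else 0) *
      F u v x := by
  simp only [expect, Finset.mul_sum]
  refine Finset.sum_congr rfl fun u _ => Finset.sum_congr rfl fun v _ =>
    Finset.sum_congr rfl fun x _ => ?_
  rw [← mul_choiceWeight hPs hPc hT]
  ring

lemma expect_expect_choiceWeight_le_one (hPs : IsPMF Ps) (hPc : ∀ s, IsPMF (Pc s))
    (hT : ∀ x s, IsPMF (T x s)) (δ : ℝ) {n : ℕ} (s : Fin n → S) :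
    (expect (iidPMF (push (stateLaw Ps Pc T) fun q => q.1.1)) fun u =>
      expect (iidPMF (push (stateLaw Ps Pc T) fun q => q.1.2.1)) fun v =>
        ∑ x, choiceWeight Ps Pc T δ s u v x) ≤ 1 := by
  classical
  have := expect_expect_choiceWeight hPs hPc hT δ s fun _ _ _ => 1
  simp only [mul_one] at this
  rw [this, ← sum_sum_sum_choiceSeq hPc s]
  refine Finset.sum_le_sum fun u _ => Finset.sum_le_sum fun v _ => Finset.sum_le_sum fun x _ => ?_
  split_ifs
  · exact le_rfl
  · exact choiceSeq_nonneg hPc s u v x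

lemma sum_choiceWeight_le (hPs : IsPMF Ps) (hPc : ∀ s, IsPMF (Pc s))
    (hT : ∀ x s, IsPMF (T x s)) (δ : ℝ) {n : ℕ} (s : Fin n → S) (u : Fin n → U) (v : Fin n → V) :
    ∑ x, choiceWeight Ps Pc T δ s u v x ≤
      Real.exp (n * (miRV (stateLaw Ps Pc T) (fun q => q.1.1) (fun q => q.1.2.1) +
        miRV (stateLaw Ps Pc T) (fun q => (q.1.1, q.1.2.1)) (fun q => q.2.1) + 2 * δ)) := by
  have hQ := isPMF_stateLaw hPs hPc hT
  unfold choiceWeight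
  split_ifs with h
  swap
  · simpa using (Real.exp_pos _).le
  obtain ⟨hus, hvs, huv, huvs⟩ := h
  have hu := (huv.pos hQ).1
  have hv := (huv.pos hQ).2
  have hs := (hus.pos hQ).2
  rw [← Finset.sum_div, sum_choiceSeq, div_le_iff₀ (by positivity)]
  have h1 := huvs.2.1
  have h2 := huv.2.1
  simp only [push_pair_state hT, push_state hPc hT, Finset.prod_mul_distrib] at h1 hs
  rw [← iidPMF] at h1
  have h3 : ∏ i, ∑ x, Pc (s i) (u i, v i, x) ≤
      Real.exp (n * (miRV (stateLaw Ps Pc T) (fun q => (q.1.1, q.1.2.1)) (fun q => q.2.1) + δ)) *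
        iidPMF (push (stateLaw Ps Pc T) fun q => (q.1.1, q.1.2.1)) fun i => (u i, v i) := by
    refine le_of_mul_le_mul_left (h1.trans_eq ?_) hs
    ring
  refine h3.trans ((mul_le_mul_of_nonneg_left h2 (Real.exp_pos _).le).trans_eq ?_)
  rw [← mul_assoc, ← Real.exp_add]
  congr 2
  ring

lemma expect_right_choiceWeight_le (hPs : IsPMF Ps) (hPc : ∀ s, IsPMF (Pc s))
    (hT : ∀ x s, IsPMF (T x s)) (δ : ℝ) {n : ℕ} (s : Fin n → S) (u : Fin n → U) :
    (expect (iidPMF (push (stateLaw Ps Pc T) fun q => q.1.2.1)) fun v =>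
        ∑ x, choiceWeight Ps Pc T δ s u v x) ≤
      Real.exp (n * (miRV (stateLaw Ps Pc T) (fun q => q.1.1) (fun q => q.2.1) + δ)) := by
  have hQ := isPMF_stateLaw hPs hPc hT
  by_cases hus : JointlyTypical (stateLaw Ps Pc T) (fun q => q.1.1) (fun q => q.2.1) δ u s
  swap
  · simp only [choiceWeight, IsGoodChoice, hus, false_and, if_false, Finset.sum_const_zero]
    simpa [expect] using (Real.exp_pos _).le
  have hu := (hus.pos hQ).1
  have hs := (hus.pos hQ).2
  have h1 := hus.2.1
  simp only [push_left_state hT, push_state hPc hT, Finset.prod_mul_distrib] at h1 hs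
  rw [← iidPMF] at h1
  have hpt : ∀ v, iidPMF (push (stateLaw Ps Pc T) fun q => q.1.2.1) v *
      ∑ x, choiceWeight Ps Pc T δ s u v x ≤
      (iidPMF (push (stateLaw Ps Pc T) fun q => q.1.1) u)⁻¹ * ∑ x, choiceSeq Pc s u v x := by
    intro v
    rw [le_inv_mul_iff₀ hu, Finset.mul_sum, Finset.mul_sum]
    refine Finset.sum_le_sum fun x _ => ?_
    rw [mul_choiceWeight hPs hPc hT]
    split_ifs
    · exact le_rfl
    · exact choiceSeq_nonneg hPc s u v x
  refine (Finset.sum_le_sum fun v _ => hpt v).trans ?_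
  rw [← Finset.mul_sum, sum_sum_choiceSeq_right, inv_mul_le_iff₀ hu]
  refine le_of_mul_le_mul_left (h1.trans_eq ?_) hs
  ring

lemma expect_left_choiceWeight_le (hPs : IsPMF Ps) (hPc : ∀ s, IsPMF (Pc s))
    (hT : ∀ x s, IsPMF (T x s)) (δ : ℝ) {n : ℕ} (s : Fin n → S) (v : Fin n → V) :
    (expect (iidPMF (push (stateLaw Ps Pc T) fun q => q.1.1)) fun u =>
        ∑ x, choiceWeight Ps Pc T δ s u v x) ≤
      Real.exp (n * (miRV (stateLaw Ps Pc T) (fun q => q.1.2.1) (fun q => q.2.1) + δ)) := by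
  have hQ := isPMF_stateLaw hPs hPc hT
  by_cases hvs : JointlyTypical (stateLaw Ps Pc T) (fun q => q.1.2.1) (fun q => q.2.1) δ v s
  swap
  · simp only [choiceWeight, IsGoodChoice, hvs, false_and, and_false, if_false,
      Finset.sum_const_zero]
    simpa [expect] using (Real.exp_pos _).le
  have hv := (hvs.pos hQ).1
  have hs := (hvs.pos hQ).2
  have h1 := hvs.2.1
  simp only [push_right_state hT, push_state hPc hT, Finset.prod_mul_distrib] at h1 hs
  rw [← iidPMF] at h1
  have hpt : ∀ u, iidPMF (push (stateLaw Ps Pc T) fun q => q.1.1) u *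
      ∑ x, choiceWeight Ps Pc T δ s u v x ≤
      (iidPMF (push (stateLaw Ps Pc T) fun q => q.1.2.1) v)⁻¹ * ∑ x, choiceSeq Pc s u v x := by
    intro u
    rw [le_inv_mul_iff₀ hv, Finset.mul_sum, Finset.mul_sum]
    refine Finset.sum_le_sum fun x _ => ?_
    rw [mul_left_comm, mul_choiceWeight hPs hPc hT]
    split_ifs
    · exact le_rfl
    · exact choiceSeq_nonneg hPc s u v x
  refine (Finset.sum_le_sum fun u _ => hpt u).trans ?_
  rw [← Finset.mul_sum, sum_sum_choiceSeq_left, inv_mul_le_iff₀ hv]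
  refine le_of_mul_le_mul_left (h1.trans_eq ?_) hs
  ring

open Classical in
lemma expect_one_sub_choiceWeight (hPs : IsPMF Ps) (hPc : ∀ s, IsPMF (Pc s))
    (hT : ∀ x s, IsPMF (T x s)) (δ : ℝ) {n : ℕ} :
    (expect (iidPMF Ps) fun s : Fin n → S => 1 -
      expect (iidPMF (push (stateLaw Ps Pc T) fun q => q.1.1)) fun u =>
        expect (iidPMF (push (stateLaw Ps Pc T) fun q => q.1.2.1)) fun v =>
          ∑ x, choiceWeight Ps Pc T δ s u v x) =
    expect (iidPMF (stateLaw Ps Pc T)) fun ω : Fin n → (U × V × X) × S × Y =>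
      if IsGoodChoice (stateLaw Ps Pc T) δ (fun i => (ω i).2.1) (fun i => (ω i).1.1)
        (fun i => (ω i).1.2.1) then 0 else 1 := by
  rw [expect_iidPMF_stateLaw]
  refine Finset.sum_congr rfl fun s _ => ?_
  have := expect_expect_choiceWeight hPs hPc hT δ s fun _ _ _ => 1
  simp only [mul_one] at this
  simp only [this]
  congr 1
  refine (congrArg (· - _) (sum_sum_sum_choiceSeq hPc s).symm).trans ?_
  simp only [← Finset.sum_sub_distrib]
  refine Finset.sum_congr rfl fun u _ => Finset.sum_congr rfl fun v _ =>
    Finset.sum_congr rfl fun x _ => ?_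
  refine Eq.trans ?_ (congrArg (choiceSeq Pc s u v x * ·) (expect_const (isPMF_chanSeq hT x s)
    (if IsGoodChoice (stateLaw Ps Pc T) δ s u v then 0 else 1)).symm)
  split_ifs <;> simp

lemma expect_choiceWeight_channel_le (hPs : IsPMF Ps) (hPc : ∀ s, IsPMF (Pc s))
    (hT : ∀ x s, IsPMF (T x s)) (δ : ℝ) {n : ℕ}
    (F : (Fin n → S) → (Fin n → U) → (Fin n → V) → (Fin n → Y) → ℝ)
    (hF : ∀ s u v y, 0 ≤ F s u v y) :
    (expect (iidPMF Ps) fun s : Fin n → S =>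
      expect (iidPMF (push (stateLaw Ps Pc T) fun q => q.1.1)) fun u =>
        expect (iidPMF (push (stateLaw Ps Pc T) fun q => q.1.2.1)) fun v =>
          ∑ y, (∑ x, choiceWeight Ps Pc T δ s u v x * chanSeq T x s y) * F s u v y) ≤
    expect (iidPMF (stateLaw Ps Pc T)) fun ω : Fin n → (U × V × X) × S × Y =>
      F (fun i => (ω i).2.1) (fun i => (ω i).1.1) (fun i => (ω i).1.2.1) (fun i => (ω i).2.2) := by
  classical
  rw [expect_iidPMF_stateLaw]
  refine Finset.sum_le_sum fun s _ => mul_le_mul_of_nonneg_left ?_ ((isPMF_iidPMF hPs).1 s)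
  have hrw : ∀ u v, ∑ y, (∑ x, choiceWeight Ps Pc T δ s u v x * chanSeq T x s y) * F s u v y =
      ∑ x, choiceWeight Ps Pc T δ s u v x * ∑ y, chanSeq T x s y * F s u v y := by
    intro u v
    simp only [Finset.sum_mul, Finset.mul_sum, mul_assoc]
    exact Finset.sum_comm
  simp only [hrw]
  rw [expect_expect_choiceWeight hPs hPc hT δ s]
  refine Finset.sum_le_sum fun u _ => Finset.sum_le_sum fun v _ => Finset.sum_le_sum fun x _ => ?_
  refine mul_le_mul_of_nonneg_right ?_ (Finset.sum_nonneg fun y _ =>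
    mul_nonneg ((isPMF_chanSeq hT x s).1 y) (hF s u v y))
  split_ifs
  · exact le_rfl
  · exact choiceSeq_nonneg hPc s u v x

open Classical in
/-- Random-coding bound for block codes, with the probability of atypical sequences made
explicit as `K / n`. -/
theorem exists_blockCode_error_le (hPs : IsPMF Ps) (hPc : ∀ s, IsPMF (Pc s))
    (hT : ∀ x s, IsPMF (T x s)) [Nonempty X] [Fintype Z₁] [Fintype Z₂] (z₁ : S → Y → Z₁)
    (z₂ : S → Y → Z₂) {δ : ℝ} (hδ : 0 < δ) :
    ∃ K : ℝ, 0 ≤ K ∧ ∀ n : ℕ, 0 < n → ∀ η : ℝ, 0 < η → ∀ M₁ M₂ L₁ L₂ : ℕ, 0 < M₁ → 0 < M₂ →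
      0 < L₁ → 0 < L₂ → ∃ (f : Fin M₁ → Fin M₂ → (Fin n → S) → Fin n → X)
        (g₁ : (Fin n → Z₁) → Fin M₁) (g₂ : (Fin n → Z₂) → Fin M₂),
        ((M₁ : ℝ) * M₂)⁻¹ * ∑ m : Fin M₁ × Fin M₂, ∑ s, iidPMF Ps s *
          ∑ y, chanSeq T (f m.1 m.2 s) s y *
            (if g₁ (fun i => z₁ (s i) (y i)) = m.1 ∧ g₂ (fun i => z₂ (s i) (y i)) = m.2
              then 0 else 1) ≤
        K / n + (η + η⁻¹ *
          (Real.exp (n * (miRV (stateLaw Ps Pc T) (fun q => q.1.1) (fun q => q.1.2.1) +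
              miRV (stateLaw Ps Pc T) (fun q => (q.1.1, q.1.2.1)) (fun q => q.2.1) + 2 * δ)) /
              (L₁ * L₂) +
            Real.exp (n * (miRV (stateLaw Ps Pc T) (fun q => q.1.1) (fun q => q.2.1) + δ)) / L₁ +
            Real.exp (n * (miRV (stateLaw Ps Pc T) (fun q => q.1.2.1) (fun q => q.2.1) + δ)) /
              L₂) +
          (M₁ - 1) * L₁ * Real.exp (-(n * (miRV (stateLaw Ps Pc T) (fun q => q.1.1)
            (fun q => z₁ q.2.1 q.2.2) - δ))) +
          (M₂ - 1) * L₂ * Real.exp (-(n * (miRV (stateLaw Ps Pc T) (fun q => q.1.2.1)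
            (fun q => z₂ q.2.1 q.2.2) - δ)))) := by
  have hQ := isPMF_stateLaw hPs hPc hT
  obtain ⟨K₁, hK₁, h₁⟩ := expect_not_jointlyTypical_le hQ (fun q => q.1.1) (fun q => q.2.1) hδ
  obtain ⟨K₂, hK₂, h₂⟩ := expect_not_jointlyTypical_le hQ (fun q => q.1.2.1) (fun q => q.2.1) hδ
  obtain ⟨K₃, hK₃, h₃⟩ := expect_not_jointlyTypical_le hQ (fun q => q.1.1) (fun q => q.1.2.1) hδ
  obtain ⟨K₄, hK₄, h₄⟩ :=
    expect_not_jointlyTypical_le hQ (fun q => (q.1.1, q.1.2.1)) (fun q => q.2.1) hδ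
  obtain ⟨K₅, hK₅, h₅⟩ :=
    expect_not_jointlyTypical_le hQ (fun q => q.1.1) (fun q => z₁ q.2.1 q.2.2) hδ
  obtain ⟨K₆, hK₆, h₆⟩ :=
    expect_not_jointlyTypical_le hQ (fun q => q.1.2.1) (fun q => z₂ q.2.1 q.2.2) hδ
  refine ⟨K₁ + K₂ + K₃ + K₄ + K₅ + K₆, by positivity, fun n hn η hη M₁ M₂ L₁ L₂ hM₁ hM₂ hL₁ hL₂ =>
    ?_⟩
  obtain ⟨f, g₁, g₂, h⟩ := exists_code_error_le (isPMF_iidPMF (ι := Fin n) hPs)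
    (fun x s => isPMF_chanSeq hT x s) (isPMF_iidPMF (isPMF_push hQ fun q => q.1.1))
    (isPMF_iidPMF (isPMF_push hQ fun q => q.1.2.1)) (choiceWeight Ps Pc T δ)
    (choiceWeight_nonneg hPs hPc hT δ) (expect_expect_choiceWeight_le_one hPs hPc hT δ) hη
    (Real.exp_pos _).le (Real.exp_pos _).le (Real.exp_pos _).le
    (sum_choiceWeight_le hPs hPc hT δ) (expect_right_choiceWeight_le hPs hPc hT δ)
    (expect_left_choiceWeight_le hPs hPc hT δ)
    (fun s y i => z₁ (s i) (y i)) (fun s y i => z₂ (s i) (y i))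
    (JointlyTypical (stateLaw Ps Pc T) (fun q => q.1.1) (fun q => z₁ q.2.1 q.2.2) δ)
    (JointlyTypical (stateLaw Ps Pc T) (fun q => q.1.2.1) (fun q => z₂ q.2.1 q.2.2) δ)
    (Real.exp_pos _).le
    (expect_jointlyTypical_le hQ (fun q => q.1.1) (fun q => z₁ q.2.1 q.2.2) δ)
    (Real.exp_pos _).le
    (expect_jointlyTypical_le hQ (fun q => q.1.2.1) (fun q => z₂ q.2.1 q.2.2) δ)
    hM₁ hM₂ hL₁ hL₂
  refine ⟨f, g₁, g₂, h.trans (add_le_add_left ?_ _)⟩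
  rw [expect_one_sub_choiceWeight hPs hPc hT]
  have hite : ∀ P : Prop, (1 - if P then (1 : ℝ) else 0) = if P then 0 else 1 := fun P => by
    split_ifs <;> norm_num
  have hite0 : ∀ P : Prop, 0 ≤ if P then (0 : ℝ) else 1 := fun P => by split_ifs <;> norm_num
  simp only [hite]
  have hgood : (expect (iidPMF (stateLaw Ps Pc T)) fun ω : Fin n → (U × V × X) × S × Y =>
      if IsGoodChoice (stateLaw Ps Pc T) δ (fun i => (ω i).2.1) (fun i => (ω i).1.1)
        (fun i => (ω i).1.2.1) then 0 else 1) ≤ K₁ / n + K₂ / n + K₃ / n + K₄ / n := by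
    refine le_trans ?_ (add_le_add (add_le_add (add_le_add (h₁ n hn) (h₂ n hn)) (h₃ n hn))
      (h₄ n hn))
    simp only [← expect_add]
    refine expect_mono (isPMF_iidPMF hQ) fun ω => ?_
    refine (le_of_eq (if_congr ?_ rfl rfl)).trans (ite_and_le _ _ _ _)
    exact Iff.rfl
  have hd₁ := (expect_choiceWeight_channel_le hPs hPc hT δ (n := n) (fun s u v y =>
    if JointlyTypical (stateLaw Ps Pc T) (fun q => q.1.1) (fun q => z₁ q.2.1 q.2.2) δ u
      (fun i => z₁ (s i) (y i)) then 0 else 1) fun s u v y => hite0 _).trans (h₅ n hn)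
  have hd₂ := (expect_choiceWeight_channel_le hPs hPc hT δ (n := n) (fun s u v y =>
    if JointlyTypical (stateLaw Ps Pc T) (fun q => q.1.2.1) (fun q => z₂ q.2.1 q.2.2) δ v
      (fun i => z₂ (s i) (y i)) then 0 else 1) fun s u v y => hite0 _).trans (h₆ n hn)
  refine (add_le_add (add_le_add hgood hd₁) hd₂).trans_eq ?_
  ring

end Block

section Asymptotics

lemma exists_natCast_exp_le (t : ℝ) : ∃ M : ℕ, 0 < M ∧ Real.exp t ≤ M ∧ (M : ℝ) - 1 ≤ Real.exp t :=
  ⟨⌈Real.exp t⌉₊, Nat.ceil_pos.2 (Real.exp_pos t), Nat.le_ceil _, by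
    linarith [Nat.ceil_lt_add_one (Real.exp_pos t).le]⟩

lemma exp_div_le {a t δ : ℝ} {n : ℕ} {L : ℝ} (hL : Real.exp (n * t) ≤ L) (h : a + δ ≤ t) :
    Real.exp (n * a) / L ≤ Real.exp (-(n * δ)) := by
  rw [div_le_iff₀ ((Real.exp_pos _).trans_le hL)]
  refine le_trans ?_ (mul_le_mul_of_nonneg_left hL (Real.exp_pos _).le)
  rw [← Real.exp_add, Real.exp_le_exp]
  have : (0 : ℝ) ≤ n * (t - (a + δ)) := mul_nonneg n.cast_nonneg (sub_nonneg.2 h)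
  linarith

lemma mul_mul_exp_le {r t I δ : ℝ} {n : ℕ} {M L : ℝ} (hM : M - 1 ≤ Real.exp (n * r))
    (hL : L - 1 ≤ Real.exp (n * t)) (hL0 : 0 ≤ L) (ht : 0 ≤ t) (h : t + r + 2 * δ ≤ I) :
    (M - 1) * L * Real.exp (-(n * (I - δ))) ≤ 2 * Real.exp (-(n * δ)) := by
  have h1 : (1 : ℝ) ≤ Real.exp (n * t) := Real.one_le_exp (mul_nonneg n.cast_nonneg ht)
  have h2 : (M - 1) * L ≤ Real.exp (n * r) * (2 * Real.exp (n * t)) :=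
    (mul_le_mul_of_nonneg_right hM hL0).trans
      (mul_le_mul_of_nonneg_left (by linarith) (Real.exp_pos _).le)
  refine (mul_le_mul_of_nonneg_right h2 (Real.exp_pos _).le).trans ?_
  have h3 : Real.exp (n * r) * (2 * Real.exp (n * t)) * Real.exp (-(n * (I - δ))) =
      2 * Real.exp (n * r + n * t + -(n * (I - δ))) := by
    rw [Real.exp_add, Real.exp_add]
    ring
  rw [h3]
  refine mul_le_mul_of_nonneg_left (Real.exp_le_exp.2 ?_) zero_le_two
  have : (0 : ℝ) ≤ n * (I - (t + r + 2 * δ)) := mul_nonneg n.cast_nonneg (sub_nonneg.2 h)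
  linarith

lemma exp_neg_mul_le {δ : ℝ} (hδ : 0 < δ) {n : ℕ} (hn : 0 < n) :
    Real.exp (-(n * δ)) ≤ δ⁻¹ / n := by
  have hn' : (0 : ℝ) < n := by exact_mod_cast hn
  rw [Real.exp_neg, inv_eq_one_div, inv_eq_one_div, div_div]
  refine one_div_le_one_div_of_le (by positivity) ?_
  linarith [Real.add_one_le_exp ((n : ℝ) * δ), mul_comm (n : ℝ) δ]

/-- Choice of blocklength, message-set sizes and numbers of codewords per message making the
random-coding bound small. -/
lemma exists_blocklength_bound_le {I₁ I₂ J₁ J₂ C R₁ R₂ ε : ℝ} (hJ₁ : 0 ≤ J₁) (hJ₂ : 0 ≤ J₂)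
    (hR₁ : R₁ ≤ I₁ - J₁) (hR₂ : R₂ ≤ I₂ - J₂) (hR : R₁ + R₂ ≤ I₁ + I₂ - C) (hε : 0 < ε)
    {K : ℝ} (hK : 0 ≤ K) :
    ∃ n M₁ M₂ L₁ L₂ : ℕ, 0 < n ∧ 0 < M₁ ∧ 0 < M₂ ∧ 0 < L₁ ∧ 0 < L₂ ∧
      R₁ - ε ≤ Real.log M₁ / n ∧ R₂ - ε ≤ Real.log M₂ / n ∧
      K / n + (ε / 2 + (ε / 2)⁻¹ * (Real.exp (n * (C + 2 * (ε / 4))) / (L₁ * L₂) +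
        Real.exp (n * (J₁ + ε / 4)) / L₁ + Real.exp (n * (J₂ + ε / 4)) / L₂) +
        (M₁ - 1) * L₁ * Real.exp (-(n * (I₁ - ε / 4))) +
        (M₂ - 1) * L₂ * Real.exp (-(n * (I₂ - ε / 4)))) ≤ ε := by
  set δ := ε / 4 with hδ
  have hδ0 : 0 < δ := by positivity
  set D := K + ((ε / 2)⁻¹ * 3 + 4) * δ⁻¹ with hD
  have hD0 : 0 ≤ D := by positivity
  obtain ⟨N, hN⟩ := exists_nat_gt (D / (ε / 2))
  have hn : 0 < N + 1 := N.succ_pos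
  generalize hn' : N + 1 = n at hn
  have hnR : (0 : ℝ) < n := by exact_mod_cast hn
  have hDn : D / n ≤ ε / 2 := by
    rw [div_lt_iff₀ (by positivity)] at hN
    rw [div_le_iff₀ hnR, ← hn']
    push_cast
    linarith
  obtain ⟨M₁, hM₁, hM₁l, hM₁u⟩ := exists_natCast_exp_le (n * (R₁ - ε))
  obtain ⟨M₂, hM₂, hM₂l, hM₂u⟩ := exists_natCast_exp_le (n * (R₂ - ε))
  obtain ⟨L₁, hL₁, hL₁l, hL₁u⟩ := exists_natCast_exp_le (n * (I₁ - (R₁ - ε) - 2 * δ))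
  obtain ⟨L₂, hL₂, hL₂l, hL₂u⟩ := exists_natCast_exp_le (n * (I₂ - (R₂ - ε) - 2 * δ))
  have hlog : ∀ {M : ℕ} {r : ℝ}, Real.exp (n * r) ≤ M → r ≤ Real.log M / n := by
    intro M r h
    rw [le_div_iff₀ hnR, mul_comm, Real.le_log_iff_exp_le ((Real.exp_pos _).trans_le h)]
    exact h
  refine ⟨n, M₁, M₂, L₁, L₂, hn, hM₁, hM₂, hL₁, hL₂, hlog hM₁l, hlog hM₂l, ?_⟩
  have e1 : Real.exp (n * (C + 2 * δ)) / (L₁ * L₂) ≤ Real.exp (-(n * δ)) := by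
    refine exp_div_le (t := I₁ - (R₁ - ε) - 2 * δ + (I₂ - (R₂ - ε) - 2 * δ)) ?_ (by linarith)
    rw [mul_add, Real.exp_add]
    exact mul_le_mul hL₁l hL₂l (Real.exp_pos _).le (Nat.cast_nonneg _)
  have e2 : Real.exp (n * (J₁ + δ)) / L₁ ≤ Real.exp (-(n * δ)) := exp_div_le hL₁l (by linarith)
  have e3 : Real.exp (n * (J₂ + δ)) / L₂ ≤ Real.exp (-(n * δ)) := exp_div_le hL₂l (by linarith)
  have e4 : ((M₁ : ℝ) - 1) * L₁ * Real.exp (-(n * (I₁ - δ))) ≤ 2 * Real.exp (-(n * δ)) :=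
    mul_mul_exp_le hM₁u hL₁u (Nat.cast_nonneg _) (by linarith) (by linarith)
  have e5 : ((M₂ : ℝ) - 1) * L₂ * Real.exp (-(n * (I₂ - δ))) ≤ 2 * Real.exp (-(n * δ)) :=
    mul_mul_exp_le hM₂u hL₂u (Nat.cast_nonneg _) (by linarith) (by linarith)
  have e6 := exp_neg_mul_le hδ0 hn
  have e7 := mul_le_mul_of_nonneg_left (add_le_add (add_le_add e1 e2) e3)
    (inv_nonneg.2 (half_pos hε).le)
  have e8 : ((ε / 2)⁻¹ * 3 + 4) * Real.exp (-(n * δ)) ≤ ((ε / 2)⁻¹ * 3 + 4) * (δ⁻¹ / n) :=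
    mul_le_mul_of_nonneg_left e6 (by positivity)
  have e9 : K / n + ((ε / 2)⁻¹ * 3 + 4) * (δ⁻¹ / n) = D / n := by
    rw [hD]
    ring
  linarith

end Asymptotics

section BroadcastSI

variable {X S1 S2 Y1 Y2 : Type*}
  [Fintype X] [Fintype S1] [Fintype S2] [Fintype Y1] [Fintype Y2]

/-- **Specialization with no eavesdropper.**
For any auxiliary alphabets `U₁, U₂` and conditional distribution `ℙ(u₁,u₂,x|s₁,s₂)`,
any rate pair with `R₁ ≤ I(U₁;Y₁,S₁) − I(U₁;S₁,S₂)`, `R₂ ≤ I(U₂;Y₂,S₂) − I(U₂;S₁,S₂)`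
and `R₁+R₂ ≤ I(U₁;Y₁,S₁) + I(U₂;Y₂,S₂) − I(U₁;U₂) − I(U₁,U₂;S₁,S₂)` is achievable. -/
theorem broadcast_side_information_achievability
    {U1 U2 : Type*} [Fintype U1] [Fintype U2]
    (Ps : S1 × S2 → ℝ) (hPs : IsPMF Ps)
    (T : X → S1 → S2 → Y1 × Y2 → ℝ) (hT : ∀ x s1 s2, IsPMF (T x s1 s2))
    (Pc : S1 → S2 → U1 × U2 × X → ℝ) (hPc : ∀ s1 s2, IsPMF (Pc s1 s2))
    (R₁ R₂ : ℝ)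
    (hR₁ : R₁ ≤ miRV (jointQ Ps T Pc) (fun q => q.1.1) (fun q => (q.2.2.1, q.2.1.1))
        - miRV (jointQ Ps T Pc) (fun q => q.1.1) (fun q => q.2.1))
    (hR₂ : R₂ ≤ miRV (jointQ Ps T Pc) (fun q => q.1.2.1) (fun q => (q.2.2.2, q.2.1.2))
        - miRV (jointQ Ps T Pc) (fun q => q.1.2.1) (fun q => q.2.1))
    (hR₁₂ : R₁ + R₂ ≤
        miRV (jointQ Ps T Pc) (fun q => q.1.1) (fun q => (q.2.2.1, q.2.1.1))
        + miRV (jointQ Ps T Pc) (fun q => q.1.2.1) (fun q => (q.2.2.2, q.2.1.2))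
        - miRV (jointQ Ps T Pc) (fun q => q.1.1) (fun q => q.1.2.1)
        - miRV (jointQ Ps T Pc) (fun q => (q.1.1, q.1.2.1)) (fun q => q.2.1))
    (ε : ℝ) (hε : 0 < ε) :
    ∃ (n M₁ M₂ : ℕ)
      (f : Fin M₁ → Fin M₂ → (Fin n → S1) → (Fin n → S2) → Fin n → X)
      (g₁ : (Fin n → Y1) → (Fin n → S1) → Fin M₁)
      (g₂ : (Fin n → Y2) → (Fin n → S2) → Fin M₂),
      0 < n ∧ 0 < M₁ ∧ 0 < M₂ ∧
      Real.log M₁ / n ≥ R₁ - ε ∧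
      Real.log M₂ / n ≥ R₂ - ε ∧
      errProb Ps T n M₁ M₂ f g₁ g₂ ≤ ε := by
  have hT' : ∀ x (s : S1 × S2), IsPMF (T x s.1 s.2) := fun x s => hT x s.1 s.2
  have hPc' : ∀ s : S1 × S2, IsPMF (Pc s.1 s.2) := fun s => hPc s.1 s.2
  have hQ : IsPMF (jointQ Ps T Pc) := isPMF_stateLaw hPs hPc' hT'
  have : Nonempty X := by
    obtain ⟨s, -⟩ := exists_le_expect (F := fun _ => 0) hPs
    obtain ⟨c, -⟩ := exists_le_expect (F := fun _ => 0) (hPc' s)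
    exact ⟨c.2.2⟩
  obtain ⟨K, hK, hcode⟩ := exists_blockCode_error_le hPs hPc' hT'
    (fun s y => (y.1, s.1)) (fun s y => (y.2, s.2)) (show 0 < ε / 4 by positivity)
  obtain ⟨n, M₁, M₂, L₁, L₂, hn, hM₁, hM₂, hL₁, hL₂, hr₁, hr₂, hle⟩ :=
    exists_blocklength_bound_le
      (C := miRV (jointQ Ps T Pc) (fun q => q.1.1) (fun q => q.1.2.1) +
        miRV (jointQ Ps T Pc) (fun q => (q.1.1, q.1.2.1)) (fun q => q.2.1))
      (miRV_nonneg hQ _ _) (miRV_nonneg hQ _ _) hR₁ hR₂ (by linarith) hε hK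
  obtain ⟨f, g₁, g₂, h⟩ := hcode n hn (ε / 2) (half_pos hε) M₁ M₂ L₁ L₂ hM₁ hM₂ hL₁ hL₂
  refine ⟨n, M₁, M₂, fun m₁ m₂ s₁ s₂ => f m₁ m₂ fun i => (s₁ i, s₂ i),
    fun y s => g₁ fun i => (y i, s i), fun y s => g₂ fun i => (y i, s i), hn, hM₁, hM₂, hr₁, hr₂,
    le_trans (le_of_eq ?_) (h.trans hle)⟩
  rw [errProb, Fintype.sum_prod_type, Finset.mul_sum]
  refine Finset.sum_congr rfl fun m _ => ?_
  rw [Fintype.sum_prod_type, Finset.mul_sum]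
  refine Finset.sum_congr rfl fun s _ => ?_
  rw [Finset.mul_sum, Finset.mul_sum]
  refine Finset.sum_congr rfl fun y _ => ?_
  simp only [codePMF, chanSeq, iidPMF]
  split_ifs
  · simp
  · ring

end BroadcastSI
end

section
/- (Gaussian wiretap channel with state known at encoder and decoder.) Consider the Gaussian wiretap channel Y = X + S + W₁, Z = X + S + W₃, where S ~ 𝒩(0,Q₁), W₁ ~ 𝒩(0,N₁), W₃ ~ 𝒩(0,N₃) are independent and i.i.d. across channel uses, the state sequence Sⁿ is known non-causally both at the encoder and at the legitimate decoder, and the input must satisfy E[X²] ≤ P. Then the capacity of the corresponding channel with state without secrecy constraint is achievable with weak secrecy: every rate R < ½·log₂(1 + P/N₁) is achievable, i.e., for every ε > 0 there exist n and a code f : ℳ×ℝⁿ → ℝⁿ (with ∥f(m,sⁿ)∥²/n ≤ P almost surely), g : ℝⁿ×ℝⁿ → ℳ with (log|ℳ|)/n ≥ R − ε, equivocation H(m|Zⁿ)/n ≥ R − ε, and ℙ(m ≠ g(Yⁿ,Sⁿ)) ≤ ε. -/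
open MeasureTheory Real

/-- Centered Gaussian probability density with variance `v`. -/
noncomputable def gpdf (v x : ℝ) : ℝ :=
  (Real.sqrt (2 * π * v))⁻¹ * Real.exp (-(x ^ 2) / (2 * v))

/-- Density (w.r.t. Lebesgue measure on `ℝⁿ`) of the eavesdropper's observation
`Zⁿ = f(m,Sⁿ) + Sⁿ + W₃ⁿ` given the message `m`, where `Sⁿ ~ 𝒩(0,Q₁)ⁿ` and
`W₃ⁿ ~ 𝒩(0,N₃)ⁿ` are independent. -/
noncomputable def outDens (n : ℕ) (Q₁ N₃ : ℝ) {M : ℕ}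
    (f : Fin M → (Fin n → ℝ) → Fin n → ℝ) (m : Fin M) (z : Fin n → ℝ) : ℝ :=
  ∫ s : Fin n → ℝ, (∏ i, gpdf Q₁ (s i)) * ∏ i, gpdf N₃ (z i - (f m s i + s i))

/-- Equivocation `H(m|Zⁿ)` (in bits) of the uniform message `m` given the continuous
observation `Zⁿ`, computed from the joint density `(1/M)·outDens`. -/
noncomputable def equivocation (n : ℕ) (Q₁ N₃ : ℝ) {M : ℕ}
    (f : Fin M → (Fin n → ℝ) → Fin n → ℝ) : ℝ :=
  ∫ z : Fin n → ℝ, ∑ m : Fin M, ((M : ℝ)⁻¹ * outDens n Q₁ N₃ f m z) *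
    Real.logb 2 ((∑ m' : Fin M, (M : ℝ)⁻¹ * outDens n Q₁ N₃ f m' z) /
      ((M : ℝ)⁻¹ * outDens n Q₁ N₃ f m z))

/-- Error probability of the legitimate decoder `g`, which observes
`Yⁿ = f(m,Sⁿ) + Sⁿ + W₁ⁿ` together with the state sequence `Sⁿ`,
with `W₁ⁿ ~ 𝒩(0,N₁)ⁿ` independent of `Sⁿ ~ 𝒩(0,Q₁)ⁿ`. -/
noncomputable def errProbG (n : ℕ) (Q₁ N₁ : ℝ) {M : ℕ}
    (f : Fin M → (Fin n → ℝ) → Fin n → ℝ)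
    (g : (Fin n → ℝ) → (Fin n → ℝ) → Fin M) : ℝ :=
  ∑ m : Fin M, (M : ℝ)⁻¹ *
    ∫ s : Fin n → ℝ, ∫ w : Fin n → ℝ,
      (∏ i, gpdf Q₁ (s i)) * (∏ i, gpdf N₁ (w i)) *
        (if g (fun i => f m s i + s i + w i) s = m then 0 else 1)

open ProbabilityTheory in
lemma gpdf_eq_gaussianPDFReal {v : ℝ} (hv : 0 < v) (x : ℝ) :
    gpdf v x = gaussianPDFReal 0 v.toNNReal x := by
  simp [gpdf, gaussianPDFReal, hv.le]

lemma gpdf_pos {v : ℝ} (hv : 0 < v) (x : ℝ) : 0 < gpdf v x := by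
  unfold gpdf; positivity

lemma continuous_gpdf (v : ℝ) : Continuous (gpdf v) := by
  unfold gpdf; fun_prop

lemma integrable_gpdf {v : ℝ} (hv : 0 < v) : Integrable (gpdf v) := by
  rw [funext (gpdf_eq_gaussianPDFReal hv)]
  exact ProbabilityTheory.integrable_gaussianPDFReal 0 v.toNNReal

lemma integral_gpdf {v : ℝ} (hv : 0 < v) : ∫ x, gpdf v x = 1 := by
  rw [funext (gpdf_eq_gaussianPDFReal hv)]
  exact ProbabilityTheory.integral_gaussianPDFReal_eq_one 0 (by simpa using hv)

/-- The law of an i.i.d. centered Gaussian vector of variance `v`. -/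
noncomputable def gaussVec (n : ℕ) (v : ℝ) : Measure (Fin n → ℝ) :=
  Measure.pi fun _ => ProbabilityTheory.gaussianReal 0 v.toNNReal

instance (n : ℕ) (v : ℝ) : IsProbabilityMeasure (gaussVec n v) := by
  unfold gaussVec; infer_instance

lemma integrable_prod_gpdf (n : ℕ) {v : ℝ} (hv : 0 < v) :
    Integrable (fun x : Fin n → ℝ => ∏ i, gpdf v (x i)) :=
  Integrable.fintype_prod fun _ => integrable_gpdf hv

lemma integral_prod_gpdf (n : ℕ) {v : ℝ} (hv : 0 < v) :
    ∫ x : Fin n → ℝ, ∏ i, gpdf v (x i) = 1 := by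
  rw [integral_fintype_prod_volume_eq_prod fun _ : Fin n => gpdf v]
  simp [integral_gpdf hv]

lemma prod_gpdf_pos {n : ℕ} {v : ℝ} (hv : 0 < v) (x : Fin n → ℝ) : 0 < ∏ i, gpdf v (x i) :=
  Finset.prod_pos fun i _ => gpdf_pos hv (x i)

lemma continuous_prod_gpdf (n : ℕ) (v : ℝ) :
    Continuous fun x : Fin n → ℝ => ∏ i, gpdf v (x i) :=
  continuous_finsetProd _ fun i _ => (continuous_gpdf v).comp (continuous_apply i)

lemma gaussVec_eq_withDensity (n : ℕ) {v : ℝ} (hv : 0 < v) :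
    gaussVec n v = volume.withDensity fun x => ENNReal.ofReal (∏ i, gpdf v (x i)) := by
  refine Measure.pi_eq fun s hs => ?_
  rw [withDensity_apply _ (MeasurableSet.univ_pi hs),
    ← ofReal_integral_eq_lintegral_ofReal (integrable_prod_gpdf n hv).integrableOn
      (ae_of_all _ fun x => (prod_gpdf_pos hv x).le),
    volume_pi, Measure.restrict_pi_pi, integral_fintype_prod_eq_prod (fun _ : Fin n => gpdf v),
    ENNReal.ofReal_prod_of_nonneg
      fun i _ => integral_nonneg fun x => (gpdf_pos hv x).le]
  refine Finset.prod_congr rfl fun i _ => ?_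
  rw [ProbabilityTheory.gaussianReal_apply_eq_integral 0 (by simpa using hv),
    funext (gpdf_eq_gaussianPDFReal hv)]

lemma integral_gaussVec (n : ℕ) {v : ℝ} (hv : 0 < v) (F : (Fin n → ℝ) → ℝ) :
    ∫ x, F x ∂(gaussVec n v) = ∫ x, (∏ i, gpdf v (x i)) * F x := by
  rw [gaussVec_eq_withDensity n hv, integral_withDensity_eq_integral_toReal_smul
    (continuous_prod_gpdf n v).measurable.ennreal_ofReal (ae_of_all _ fun _ => by simp)]
  simp [ENNReal.toReal_ofReal (prod_gpdf_pos hv _).le]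

/-- Every finite family of sets admits a measurable selector that is correct at points lying in
exactly one member. -/
lemma exists_measurable_selector {E : Type*} [MeasurableSpace E] {M : ℕ} [NeZero M]
    (A : Fin M → Set E) (hA : ∀ m, MeasurableSet (A m)) :
    ∃ dec : E → Fin M, Measurable dec ∧
      ∀ m y, y ∈ A m → (∀ m' ≠ m, y ∉ A m') → dec y = m := by
  classical
  refine ⟨fun y => ∑ m, if y ∈ A m then m else 0, ?_, fun m y hy h => ?_⟩
  · exact Finset.measurable_sum _ fun m _ => Measurable.ite (hA m) measurable_const measurable_const
  · simp only
    rw [Finset.sum_eq_single m (fun m' _ hm' => if_neg (h m' hm')) (by simp), if_pos hy]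

/-- One-shot random coding bound for an additive-noise channel with an input constraint. -/
lemma exists_codebook {E : Type*} [MeasurableSpace E] [Add E] [MeasurableAdd₂ E]
    (ν ω : Measure E) [IsProbabilityMeasure ν] [IsProbabilityMeasure ω]
    {F : Set E} (hF : MeasurableSet F) {x₀ : E} (hx₀ : x₀ ∈ F)
    {T : Set (E × E)} (hT : MeasurableSet T) {β : ENNReal}
    (hβ : ∀ y, ν {x | (x, y) ∈ T} ≤ β) (M : ℕ) [NeZero M] :
    ∃ c : Fin M → E, (∀ m, c m ∈ F) ∧ ∃ dec : E → Fin M, Measurable dec ∧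
      ∑ m, ω {w | dec (c m + w) ≠ m} ≤
        M * ((ν.prod ω) {p | p.1 ∉ F ∨ (p.1, p.1 + p.2) ∉ T} + M * β) := by
  classical
  set t : E → E := fun x => if x ∈ F then x else x₀ with ht
  have htm : Measurable t := Measurable.ite hF measurable_id measurable_const
  set B : Set (E × E) := {p | p.1 ∉ F ∨ (p.1, p.1 + p.2) ∉ T} with hB
  have hBm : MeasurableSet B := by
    refine (measurable_fst hF.compl).union ?_
    exact (measurable_fst.prodMk (measurable_fst.add measurable_snd)) hT.compl
  have hDm : MeasurableSet {q : (E × E) × E | (q.1.1, t q.1.2 + q.2) ∈ T} := by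
    refine (Measurable.prodMk (by fun_prop) ?_) hT
    exact (htm.comp (by fun_prop)).add measurable_snd
  set a : E → ENNReal := fun x => ω {w | (x, w) ∈ B} with ha
  set b : E × E → ENNReal := fun q => ω {w | (q.1, t q.2 + w) ∈ T} with hb
  have ham : Measurable a := measurable_measure_prodMk_left hBm
  have hbm : Measurable b := measurable_measure_prodMk_left hDm
  have hamean : ∫⁻ x, a x ∂ν = (ν.prod ω) B := (Measure.prod_apply hBm).symm
  have hbmean : ∫⁻ q, b q ∂(ν.prod ν) ≤ β := by
    rw [lintegral_prod_symm _ hbm.aemeasurable]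
    have : ∀ x, ∫⁻ x', b (x', x) ∂ν ≤ β := by
      intro x
      have hS : MeasurableSet {q : E × E | (q.1, t x + q.2) ∈ T} :=
        (measurable_fst.prodMk (measurable_const.add measurable_snd)) hT
      calc ∫⁻ x', b (x', x) ∂ν = (ν.prod ω) {q : E × E | (q.1, t x + q.2) ∈ T} :=
            (Measure.prod_apply hS).symm
        _ = ∫⁻ w, ν {x' | (x', t x + w) ∈ T} ∂ω := Measure.prod_apply_symm hS
        _ ≤ ∫⁻ _, β ∂ω := lintegral_mono fun w => hβ _
        _ = β := by simp
    calc ∫⁻ x, ∫⁻ x', b (x', x) ∂ν ∂ν ≤ ∫⁻ _, β ∂ν := lintegral_mono this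
      _ = β := by simp
  set Λ : Measure (Fin M → E) := Measure.pi fun _ => ν with hΛ
  have hpair : ∀ m m' : Fin M, m' ≠ m → Λ.map (fun C => (C m', C m)) = ν.prod ν := by
    intro m m' hne
    have hi := ProbabilityTheory.iIndepFun_pi (μ := fun _ : Fin M => ν) (X := fun _ => id)
      fun _ => aemeasurable_id
    have h2 := (hi.indepFun hne).map_prod_eq_prod_map_map
      (measurable_pi_apply m').aemeasurable (measurable_pi_apply m).aemeasurable
    rw [hΛ, h2]
    congr 1
    · exact (measurePreserving_eval (fun _ : Fin M => ν) m').map_eq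
    · exact (measurePreserving_eval (fun _ : Fin M => ν) m).map_eq
  set G : (Fin M → E) → ENNReal := fun C =>
    ∑ m, (a (C m) + ∑ m' ∈ Finset.univ.erase m, b (C m', C m)) with hG
  have hGmean : ∫⁻ C, G C ∂Λ ≤ M * ((ν.prod ω) B + M * β) := by
    rw [hG, lintegral_finsetSum _ (by fun_prop)]
    calc ∑ m, ∫⁻ C, (a (C m) + ∑ m' ∈ Finset.univ.erase m, b (C m', C m)) ∂Λ
        ≤ ∑ m : Fin M, ((ν.prod ω) B + M * β) := by
          refine Finset.sum_le_sum fun m _ => ?_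
          rw [lintegral_add_left (by fun_prop), lintegral_finsetSum _ (by fun_prop)]
          refine add_le_add ?_ ?_
          · rw [← hamean, ← (measurePreserving_eval (fun _ : Fin M => ν) m).lintegral_comp ham]
          · calc ∑ m' ∈ Finset.univ.erase m, ∫⁻ C, b (C m', C m) ∂Λ
                ≤ ∑ m' ∈ Finset.univ.erase m, β := by
                  refine Finset.sum_le_sum fun m' hm' => ?_
                  rw [← lintegral_map (f := b) (g := fun C : Fin M → E => (C m', C m)) hbm
                    (by fun_prop), hpair m m' (Finset.ne_of_mem_erase hm')]
                  exact hbmean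
              _ ≤ M * β := by
                  rw [Finset.sum_const, nsmul_eq_mul]
                  gcongr
                  simp
      _ = M * ((ν.prod ω) B + M * β) := by simp [mul_add]
  obtain ⟨C, hC⟩ := exists_le_lintegral (μ := Λ) (f := G)
    (by rw [hG]; exact Measurable.aemeasurable (by fun_prop))
  refine ⟨fun m => t (C m), fun m => ?_, ?_⟩
  · simp only [ht]; split_ifs with h <;> assumption
  obtain ⟨dec, hdm, hdec⟩ := exists_measurable_selector (fun m => {y | (C m, y) ∈ T})
    fun m => (measurable_const.prodMk measurable_id) hT
  refine ⟨dec, hdm, ?_⟩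
  refine le_trans (Finset.sum_le_sum fun m _ => ?_) (hC.trans hGmean)
  have hsub : {w | dec (t (C m) + w) ≠ m} ⊆ {w | (C m, w) ∈ B} ∪
      ⋃ m' ∈ Finset.univ.erase m, {w | (C m', t (C m) + w) ∈ T} := by
    intro w hw
    by_contra hcon
    simp only [Set.mem_union, Set.mem_iUnion, Set.mem_ofPred_eq, hB, not_or, not_not,
      Finset.mem_erase, Finset.mem_univ, and_true, not_exists] at hcon
    obtain ⟨⟨h1, h2⟩, h3⟩ := hcon
    refine hw (hdec m _ ?_ fun m' hm' => h3 m' hm')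
    simpa [ht, h1] using h2
  calc ω {w | dec (t (C m) + w) ≠ m} ≤ _ := measure_mono hsub
    _ ≤ _ := (measure_union_le _ _).trans
      (add_le_add le_rfl (measure_biUnion_finset_le _ _))

open Filter Topology ProbabilityTheory in
/-- Weak law of large numbers for i.i.d. square-integrable samples, as a one-sided deviation
bound. -/
lemma tendsto_measure_sum_ge {Ω : Type*} [MeasurableSpace Ω] (μ : Measure Ω)
    [IsProbabilityMeasure μ] {φ : Ω → ℝ} (hφ : MemLp φ 2 μ) {κ : ℝ} (hκ : ∫ x, φ x ∂μ < κ) :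
    Tendsto (fun n : ℕ => (Measure.pi fun _ : Fin n => μ) {x | n * κ ≤ ∑ i, φ (x i)})
      atTop (𝓝 0) := by
  set η := κ - ∫ x, φ x ∂μ with hη
  have hη0 : 0 < η := sub_pos.2 hκ
  have hlim : Tendsto (fun n : ℕ => ENNReal.ofReal (Var[φ; μ] / η ^ 2 / n)) atTop (𝓝 0) := by
    rw [← ENNReal.ofReal_zero]
    exact ENNReal.tendsto_ofReal (tendsto_const_div_atTop_nhds_zero_nat _)
  refine tendsto_of_tendsto_of_tendsto_of_le_of_le' tendsto_const_nhds hlim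
    (Eventually.of_forall fun _ => zero_le) ?_
  filter_upwards [eventually_gt_atTop 0] with n hn
  have hn' : (0 : ℝ) < n := Nat.cast_pos.2 hn
  have hcoord : ∀ i : Fin n, MemLp (fun x : Fin n → Ω => φ (x i)) 2 (Measure.pi fun _ => μ) :=
    fun i => hφ.comp_measurePreserving (measurePreserving_eval (fun _ : Fin n => μ) i)
  have hS : MemLp (∑ i : Fin n, fun x : Fin n → Ω => φ (x i)) 2 (Measure.pi fun _ => μ) :=
    memLp_finsetSum' _ fun i _ => hcoord i
  have hvar := variance_sum_pi (μ := fun _ : Fin n => μ) (X := fun _ => φ) fun _ => hφ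
  have hmean : ∫ x, (∑ i : Fin n, fun x : Fin n → Ω => φ (x i)) x ∂(Measure.pi fun _ => μ)
      = n * ∫ x, φ x ∂μ := by
    simp only [Finset.sum_apply]
    rw [integral_finsetSum _ fun i _ => (hcoord i).integrable (by norm_num)]
    have : ∀ i : Fin n, ∫ x : Fin n → Ω, φ (x i) ∂(Measure.pi fun _ => μ) = ∫ x, φ x ∂μ :=
      fun i => integral_comp_eval (μ := fun _ : Fin n => μ) hφ.1
    simp [this]
  have hcheb := meas_ge_le_variance_div_sq hS (mul_pos hn' hη0)
  rw [hvar, hmean] at hcheb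
  refine (measure_mono fun x hx => ?_).trans (hcheb.trans_eq ?_)
  · simp only [Set.mem_ofPred_eq, Finset.sum_apply] at hx ⊢
    refine le_trans ?_ (le_abs_self _)
    rw [hη]; linarith
  · congr 1
    simp only [Finset.sum_const, Finset.card_univ, Fintype.card_fin, nsmul_eq_mul]
    field_simp

open ProbabilityTheory in
lemma integral_exp_neg_sq_sub_gaussianReal {P N : ℝ} (hP : 0 < P) (hN : 0 < N) (y : ℝ) :
    ∫ x, Real.exp (y ^ 2 / (2 * (P + N)) - (y - x) ^ 2 / (2 * N)) ∂(gaussianReal 0 P.toNNReal)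
      = Real.exp (-(1 / 2 * Real.log (1 + P / N))) := by
  rw [integral_gaussianReal_eq_integral_smul (by simpa using hP)]
  have hpt : ∀ x, gaussianPDFReal 0 P.toNNReal x •
      Real.exp (y ^ 2 / (2 * (P + N)) - (y - x) ^ 2 / (2 * N)) =
      (Real.sqrt (2 * π * P))⁻¹ *
        Real.exp (-((P + N) / (2 * P * N)) * (x - y * P / (P + N)) ^ 2) := by
    intro x
    rw [← gpdf_eq_gaussianPDFReal hP, gpdf, smul_eq_mul, mul_assoc, ← Real.exp_add]
    congr 2
    have : P + N ≠ 0 := by positivity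
    field_simp
    ring
  simp_rw [hpt]
  rw [integral_const_mul,
    integral_sub_right_eq_self (fun x => Real.exp (-((P + N) / (2 * P * N)) * x ^ 2)),
    integral_gaussian, ← Real.sqrt_inv, ← Real.sqrt_mul (by positivity),
    show -(1 / 2 * Real.log (1 + P / N)) = Real.log (1 + P / N)⁻¹ / 2 by rw [Real.log_inv]; ring,
    ← Real.log_sqrt (by positivity), Real.exp_log (by positivity)]
  · congr 1
    field_simp
    ring

lemma gaussVec_test_le {n : ℕ} {P N η : ℝ} (hP : 0 < P) (hN : 0 < N) (y : Fin n → ℝ) :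
    gaussVec n P {x | ∑ i, ((y i - x i) ^ 2 / (2 * N) - y i ^ 2 / (2 * (P + N))) ≤ n * η} ≤
      ENNReal.ofReal (Real.exp (n * (η - 1 / 2 * Real.log (1 + P / N)))) := by
  set g : (Fin n → ℝ) → ℝ := fun x => Real.exp (n * η) *
    ∏ i, Real.exp (y i ^ 2 / (2 * (P + N)) - (y i - x i) ^ 2 / (2 * N)) with hg
  have hgc : Continuous g := by fun_prop
  have hg0 : ∀ x, 0 ≤ g x := fun x => by positivity
  have hint : ∫ x, g x ∂(gaussVec n P) =
      Real.exp (n * (η - 1 / 2 * Real.log (1 + P / N))) := by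
    rw [hg, integral_const_mul, gaussVec, integral_fintype_prod_eq_prod
      (fun i x => Real.exp (y i ^ 2 / (2 * (P + N)) - (y i - x) ^ 2 / (2 * N)))]
    simp_rw [integral_exp_neg_sq_sub_gaussianReal hP hN]
    rw [Finset.prod_const, Finset.card_univ, Fintype.card_fin, ← Real.exp_nat_mul, ← Real.exp_add]
    congr 1; ring
  have hgi : Integrable g (gaussVec n P) := by
    by_contra h
    have := integral_undef h
    rw [hint] at this
    exact (Real.exp_pos _).ne' this
  rw [← hint, ofReal_integral_eq_lintegral_ofReal hgi (ae_of_all _ hg0)]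
  refine le_trans (measure_mono fun x hx => ?_) ((one_mul _).symm.trans_le
    (mul_meas_ge_le_lintegral hgc.measurable.ennreal_ofReal 1))
  simp only [Set.mem_ofPred_eq] at hx ⊢
  rw [ENNReal.one_le_ofReal, hg]
  simp only
  rw [← Real.exp_sum, ← Real.exp_add, Real.one_le_exp_iff]
  have : ∑ i, (y i ^ 2 / (2 * (P + N)) - (y i - x i) ^ 2 / (2 * N)) =
      -∑ i, ((y i - x i) ^ 2 / (2 * N) - y i ^ 2 / (2 * (P + N))) := by
    rw [← Finset.sum_neg_distrib]; exact Finset.sum_congr rfl fun i _ => by ring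
  linarith

open ProbabilityTheory in
lemma integral_sq_gaussianReal {v : ℝ} (hv : 0 < v) :
    ∫ x, x ^ 2 ∂(gaussianReal 0 v.toNNReal) = v := by
  have h := variance_of_integral_eq_zero (μ := gaussianReal 0 v.toNNReal) (X := fun x => x)
    aemeasurable_id integral_id_gaussianReal
  rw [variance_fun_id_gaussianReal] at h
  simpa [hv.le] using h.symm

instance : ENNReal.HolderTriple 4 4 2 where
  inv_add_inv_eq_inv := by
    rw [← two_mul, show (4 : ENNReal) = 2 * 2 by norm_num,
      ENNReal.mul_inv (by simp) (by simp), ← mul_assoc,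
      ENNReal.mul_inv_cancel (by simp) (by simp), one_mul]

open Filter Topology ProbabilityTheory in
lemma tendsto_gaussVec_bad {P P' N η : ℝ} (hP : 0 < P) (hN : 0 < N) (hPP' : P < P')
    (hη : 0 < η) :
    Tendsto (fun n : ℕ => ((gaussVec n P).prod (gaussVec n N))
      {p | p.1 ∉ {x : Fin n → ℝ | ∑ i, x i ^ 2 ≤ n * P'} ∨
        (p.1, p.1 + p.2) ∉ {q : (Fin n → ℝ) × (Fin n → ℝ) |
          ∑ i, ((q.2 i - q.1 i) ^ 2 / (2 * N) - q.2 i ^ 2 / (2 * (P + N))) ≤ n * η}})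
      atTop (𝓝 0) := by
  set μ := (gaussianReal 0 P.toNNReal).prod (gaussianReal 0 N.toNNReal) with hμ
  have hX : MemLp (fun p : ℝ × ℝ => p.1) 4 μ :=
    (memLp_id_gaussianReal' 4 (by simp)).comp_measurePreserving measurePreserving_fst
  have hW : MemLp (fun p : ℝ × ℝ => p.2) 4 μ :=
    (memLp_id_gaussianReal' 4 (by simp)).comp_measurePreserving measurePreserving_snd
  have hXX : MemLp (fun p : ℝ × ℝ => p.1 * p.1) 2 μ := hX.mul' hX
  have hXW : MemLp (fun p : ℝ × ℝ => p.1 * p.2) 2 μ := hW.mul' hX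
  have hWW : MemLp (fun p : ℝ × ℝ => p.2 * p.2) 2 μ := hW.mul' hW
  have hiXX : ∫ p : ℝ × ℝ, p.1 * p.1 ∂μ = P := by
    simp_rw [← pow_two]
    have := integral_fun_fst (μ := gaussianReal 0 P.toNNReal) (ν := gaussianReal 0 N.toNNReal)
      (fun x : ℝ => x ^ 2)
    simpa [integral_sq_gaussianReal hP] using this
  have hiWW : ∫ p : ℝ × ℝ, p.2 * p.2 ∂μ = N := by
    simp_rw [← pow_two]
    have := integral_fun_snd (μ := gaussianReal 0 P.toNNReal) (ν := gaussianReal 0 N.toNNReal)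
      (fun x : ℝ => x ^ 2)
    simpa [integral_sq_gaussianReal hN] using this
  have hiXW : ∫ p : ℝ × ℝ, p.1 * p.2 ∂μ = 0 := by
    rw [hμ, integral_prod_mul (fun x : ℝ => x) (fun x : ℝ => x), integral_id_gaussianReal, zero_mul]
  set A : ℝ := 1 / (2 * N) with hA
  set B : ℝ := 1 / (2 * (P + N)) with hB
  set φ : ℝ × ℝ → ℝ := fun p =>
    (A - B) * (p.2 * p.2) - (2 * B) * (p.1 * p.2) - B * (p.1 * p.1) with hφ
  have hφL : MemLp φ 2 μ :=
    ((hWW.const_mul (A - B)).sub (hXW.const_mul (2 * B))).sub (hXX.const_mul B)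
  have hφm : ∫ p, φ p ∂μ = 0 := by
    have i1 := (hWW.integrable (by norm_num)).const_mul (A - B)
    have i2 := (hXW.integrable (by norm_num)).const_mul (2 * B)
    have i3 := (hXX.integrable (by norm_num)).const_mul B
    have i12 : Integrable (fun p : ℝ × ℝ =>
      (A - B) * (p.2 * p.2) - (2 * B) * (p.1 * p.2)) μ := i1.sub i2
    rw [hφ, integral_sub i12 i3, integral_sub i1 i2, integral_const_mul,
      integral_const_mul, integral_const_mul, hiXX, hiWW, hiXW, hA, hB]
    have : P + N ≠ 0 := by positivity
    field_simp
    ring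
  have t1 := tendsto_measure_sum_ge μ hXX (hiXX.trans_lt hPP')
  have t2 := tendsto_measure_sum_ge μ hφL (hφm.trans_lt hη)
  refine tendsto_of_tendsto_of_tendsto_of_le_of_le tendsto_const_nhds
    (by simpa using t1.add t2) (fun _ => zero_le) fun n => ?_
  have hmp := measurePreserving_arrowProdEquivProdArrow ℝ ℝ (Fin n)
    (fun _ => gaussianReal 0 P.toNNReal) (fun _ => gaussianReal 0 N.toNNReal)
  simp only [gaussVec]
  rw [← hmp.measure_preimage_equiv]
  refine (measure_mono ?_).trans (measure_union_le _ _)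
  intro x hx
  simp only [MeasurableEquiv.arrowProdEquivProdArrow, Equiv.arrowProdEquivProdArrow,
    MeasurableEquiv.coe_mk, Equiv.coe_fn_mk, Set.mem_preimage, Set.mem_ofPred_eq, not_le,
    Pi.add_apply, Set.mem_union] at hx ⊢
  refine hx.imp (fun h => ?_) fun h => ?_
  · refine h.le.trans_eq (Finset.sum_congr rfl fun i _ => pow_two _)
  · refine h.le.trans_eq (Finset.sum_congr rfl fun i _ => ?_)
    rw [hφ, hA, hB]
    ring

open Filter Topology in
/-- Achievability for the additive white Gaussian noise channel under a per-codeword power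
constraint. -/
lemma exists_awgn_code {P N r ε : ℝ} (hP : 0 < P) (hN : 0 < N)
    (hr : r < 1 / 2 * Real.log (1 + P / N)) (hε : 0 < ε) :
    ∃ n M : ℕ, 0 < n ∧ 0 < M ∧ n * r < Real.log M ∧
      ∃ c : Fin M → Fin n → ℝ, (∀ m, ∑ i, c m i ^ 2 ≤ n * P) ∧
      ∃ dec : (Fin n → ℝ) → Fin M, Measurable dec ∧
        ∑ m, (gaussVec n N) {w | dec (c m + w) ≠ m} ≤ M * ENNReal.ofReal ε := by
  set r₀ := max r 0 with hr₀
  have hr₀P : r₀ < 1 / 2 * Real.log (1 + P / N) :=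
    max_lt hr (mul_pos (by norm_num) (Real.log_pos (by linarith [div_pos hP hN])))
  obtain ⟨Q, hQr, hQ0, hQP⟩ : ∃ Q, r₀ < 1 / 2 * Real.log (1 + Q / N) ∧ 0 < Q ∧ Q < P := by
    have hc : ContinuousAt (fun Q : ℝ => 1 / 2 * Real.log (1 + Q / N)) P := by
      refine continuousAt_const.mul (ContinuousAt.log (by fun_prop) ?_)
      have := div_pos hP hN
      positivity
    have h1 := hc.eventually (lt_mem_nhds hr₀P)
    have h2 := (h1.and (lt_mem_nhds hP)).filter_mono (nhdsWithin_le_nhds (s := Set.Iio P))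
    obtain ⟨Q, ⟨hQ, hQ0⟩, hQP⟩ := (h2.and self_mem_nhdsWithin).exists
    exact ⟨Q, hQ, hQ0, hQP⟩
  set C := 1 / 2 * Real.log (1 + Q / N) with hC
  set η := (C - r₀) / 3 with hη
  have hη0 : 0 < η := by rw [hη]; linarith
  have hbad := tendsto_gaussVec_bad hQ0 hN hQP hη0
  have hdec : Tendsto (fun n : ℕ => 2 * Real.exp (-(n * η))) atTop (𝓝 0) := by
    have h := (Real.tendsto_exp_neg_atTop_nhds_zero.comp
      (tendsto_natCast_atTop_atTop.atTop_mul_const hη0)).const_mul 2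
    simpa [Function.comp_def] using h
  obtain ⟨n, ⟨hn1, hn2⟩, hn0⟩ := ((((ENNReal.tendsto_nhds_zero.1 hbad)
    (ENNReal.ofReal (ε / 2)) (by simpa using hε)).and
    (hdec.eventually (gt_mem_nhds (half_pos hε)))).and (eventually_gt_atTop 0)).exists
  set M := ⌈Real.exp (n * (r₀ + η))⌉₊ with hM
  have hM0 : 0 < M := Nat.ceil_pos.2 (Real.exp_pos _)
  have hn' : (0 : ℝ) < n := Nat.cast_pos.2 hn0
  have hr₀0 : 0 ≤ r₀ := le_max_right _ _
  have : NeZero M := ⟨hM0.ne'⟩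
  have hMlog : n * r < Real.log M := by
    have h1 : Real.exp (n * (r₀ + η)) ≤ M := Nat.le_ceil _
    have h2 := (Real.le_log_iff_exp_le (by positivity)).2 h1
    refine lt_of_lt_of_le ?_ h2
    refine mul_lt_mul_of_pos_left ?_ hn'
    linarith [le_max_left r 0]
  have hMle : (M : ℝ) ≤ 2 * Real.exp (n * (r₀ + η)) := by
    have h1 := (Nat.ceil_lt_add_one (Real.exp_pos (n * (r₀ + η))).le).le
    have h2 := Real.one_le_exp (x := n * (r₀ + η)) (by positivity)
    rw [← hM] at h1
    linarith
  have hMβ : (M : ENNReal) * ENNReal.ofReal (Real.exp (n * (η - C))) ≤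
      ENNReal.ofReal (ε / 2) := by
    rw [← ENNReal.ofReal_natCast, ← ENNReal.ofReal_mul (by positivity)]
    refine ENNReal.ofReal_le_ofReal (le_trans ?_ hn2.le)
    calc (M : ℝ) * Real.exp (n * (η - C))
        ≤ 2 * Real.exp (n * (r₀ + η)) * Real.exp (n * (η - C)) := by gcongr
      _ = 2 * Real.exp (-(n * η)) := by
        rw [mul_assoc, ← Real.exp_add, hη]; congr 2; ring
  obtain ⟨c, hcF, dec, hdm, herr⟩ := exists_codebook (gaussVec n Q) (gaussVec n N)
    (F := {x : Fin n → ℝ | ∑ i, x i ^ 2 ≤ n * P})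
    (measurableSet_le (by fun_prop) measurable_const) (x₀ := 0)
    (by simp only [Set.mem_ofPred_eq]; simp; positivity)
    (T := {q : (Fin n → ℝ) × (Fin n → ℝ) |
      ∑ i, ((q.2 i - q.1 i) ^ 2 / (2 * N) - q.2 i ^ 2 / (2 * (Q + N))) ≤ n * η})
    (measurableSet_le (by fun_prop) measurable_const)
    (fun y => gaussVec_test_le hQ0 hN y) M
  refine ⟨n, M, hn0, hM0, hMlog, c, hcF, dec, hdm, herr.trans ?_⟩
  gcongr
  rw [← add_halves ε, ENNReal.ofReal_add (by positivity) (by positivity)]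
  exact add_le_add hn1 hMβ

/-- One-time-pad key extracted from the fine quantization cell of a single state coordinate. -/
noncomputable def stateKey {n : ℕ} (i₀ : Fin n) (M : ℕ) [NeZero M] (t : ℕ) (s : Fin n → ℝ) :
    Fin M :=
  ⌊((t : ℝ) + 1) * s i₀⌋ • (1 : Fin M)

lemma measurable_stateKey {n : ℕ} (i₀ : Fin n) (M : ℕ) [NeZero M] (t : ℕ) :
    Measurable (stateKey i₀ M t) :=
  (Measurable.of_discrete (f := fun k : ℤ => k • (1 : Fin M))).comp
    (((measurable_pi_apply i₀).const_mul _).floor)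

lemma stateKey_add_single {n : ℕ} (i₀ : Fin n) (M : ℕ) [NeZero M] (t : ℕ) (s : Fin n → ℝ) :
    stateKey i₀ M t (s + Pi.single i₀ ((t : ℝ) + 1)⁻¹) = 1 + stateKey i₀ M t s := by
  have h : ((t : ℝ) + 1) * (s i₀ + ((t : ℝ) + 1)⁻¹) = ((t : ℝ) + 1) * s i₀ + 1 := by
    field_simp
  rw [stateKey, Pi.add_apply, Pi.single_eq_same, h, Int.floor_add_one, add_zsmul, one_zsmul,
    add_comm, stateKey]

lemma Fin.val_nsmul_one {M : ℕ} [NeZero M] (x : Fin M) : x.val • (1 : Fin M) = x := by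
  have h : ∀ k : ℕ, (k • (1 : Fin M)).val = k % M := fun k => by
    induction k with
    | zero => simp
    | succ k ih => rw [succ_nsmul, Fin.val_add, ih, Fin.val_one', Nat.add_mod_mod, Nat.mod_add_mod]
  exact Fin.ext ((h _).trans (Nat.mod_eq_of_lt x.isLt))

open Filter Topology in
/-- The extracted key becomes uniform, and independent of every fixed integrable weight, as the
quantization gets finer. -/
lemma tendsto_integral_stateKey {n : ℕ} (i₀ : Fin n) (M : ℕ) [NeZero M] {h : (Fin n → ℝ) → ℝ}
    (hc : Continuous h) (hi : Integrable h) (h0 : ∀ s, 0 ≤ h s) (m j : Fin M) :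
    Tendsto (fun t => ∫ s, if m + stateKey i₀ M t s = j then h s else 0) atTop
      (𝓝 ((M : ℝ)⁻¹ * ∫ s, h s)) := by
  set v : ℕ → Fin n → ℝ := fun t => Pi.single i₀ ((t : ℝ) + 1)⁻¹ with hv
  have hv0 : Tendsto v atTop (𝓝 0) := by
    refine tendsto_pi_nhds.2 fun i => ?_
    by_cases hii : i = i₀
    · subst hii
      simpa [hv, Function.comp_def] using tendsto_one_div_add_atTop_nhds_zero_nat (𝕜 := ℝ)
    · simp [hv, Pi.single_eq_of_ne hii]
  set e : ℕ → ℝ := fun t => ∫ s, max (h s - h (s + v t)) 0 with he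
  have hiv : ∀ t, Integrable fun s => h (s + v t) := fun t => hi.comp_add_right (v t)
  have hei : ∀ t, Integrable fun s => max (h s - h (s + v t)) 0 := fun t =>
    (hi.sub (hiv t)).pos_part
  have he0 : Tendsto e atTop (𝓝 0) := by
    have : Tendsto e atTop (𝓝 (∫ _ : Fin n → ℝ, (0 : ℝ))) := by
      refine tendsto_integral_of_dominated_convergence h (fun t => (hei t).1) hi
        (fun t => ae_of_all _ fun s => ?_) (ae_of_all _ fun s => ?_)
      · rw [Real.norm_of_nonneg (le_max_right _ _)]
        exact max_le (by linarith [h0 (s + v t)]) (h0 s)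
      · have h1 : Tendsto (fun t => h (s + v t)) atTop (𝓝 (h s)) := by
          have h2 : Tendsto (fun t => s + v t) atTop (𝓝 s) := by
            simpa using hv0.const_add s
          exact (hc.tendsto s).comp h2
        simpa using (h1.const_sub (h s)).max (tendsto_const_nhds (x := (0 : ℝ)))
    simpa using this
  set a : ℕ → Fin M → ℝ := fun t m => ∫ s, if m + stateKey i₀ M t s = j then h s else 0 with ha
  have hmeas : ∀ t m, MeasurableSet {s : Fin n → ℝ | m + stateKey i₀ M t s = j} := fun t m =>
    ((measurable_stateKey i₀ M t).const_add m) (measurableSet_singleton j)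
  have hai : ∀ t m, ∀ u : (Fin n → ℝ) → ℝ, Integrable u →
      Integrable fun s => if m + stateKey i₀ M t s = j then u s else 0 := fun t m u hu =>
    (hu.indicator (hmeas t m)).congr (ae_of_all _ fun s => by simp [Set.indicator])
  have hstep : ∀ t m, a t (m + 1) ≤ a t m + e t := by
    intro t m
    have h1 : a t m = ∫ s, if (m + 1) + stateKey i₀ M t s = j then h (s + v t) else 0 := by
      rw [ha]
      simp only
      rw [← integral_add_right_eq_self _ (v t)]
      simp_rw [hv, stateKey_add_single, add_assoc]
    rw [h1, he, ← integral_add (hai t _ _ (hiv t)) (hei t)]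
    refine integral_mono (hai t _ _ hi) ((hai t _ _ (hiv t)).add (hei t)) fun s => ?_
    simp only
    split_ifs
    · linarith [le_max_left (h s - h (s + v t)) 0]
    · linarith [le_max_right (h s - h (s + v t)) 0]
  have he_nonneg : ∀ t, 0 ≤ e t := fun t => integral_nonneg fun s => le_max_right _ _
  have hiter : ∀ t m (k : ℕ), a t (m + k • 1) ≤ a t m + k * e t := by
    intro t m k
    induction k with
    | zero => simp
    | succ k ih =>
      rw [succ_nsmul, ← add_assoc]
      push_cast
      linarith [hstep t (m + k • 1)]
  have hcomp : ∀ t m m', a t m' ≤ a t m + M * e t := by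
    intro t m m'
    have h1 : m + (m' - m).val • (1 : Fin M) = m' := by
      rw [Fin.val_nsmul_one]
      abel
    have h2 := hiter t m (m' - m).val
    rw [h1] at h2
    have h3 : ((m' - m).val : ℝ) ≤ M := by exact_mod_cast (m' - m).isLt.le
    nlinarith [he_nonneg t]
  have hsum : ∀ t, ∑ m, a t m = ∫ s, h s := by
    intro t
    rw [ha]
    simp only
    rw [← integral_finsetSum _ fun m _ => hai t m h hi]
    refine integral_congr_ae (ae_of_all _ fun s => ?_)
    simp only
    rw [Finset.sum_eq_single (j - stateKey i₀ M t s)]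
    · simp
    · intro m _ hm
      exact if_neg fun hcon => hm (eq_sub_of_add_eq hcon)
    · simp
  have hM : (0 : ℝ) < M := Nat.cast_pos.2 (NeZero.pos M)
  have hup : ∀ t, a t m ≤ (M : ℝ)⁻¹ * (∫ s, h s) + M * e t := by
    intro t
    have : ∑ _m' : Fin M, a t m ≤ ∑ m', (a t m' + M * e t) :=
      Finset.sum_le_sum fun m' _ => hcomp t m' m
    rw [Finset.sum_add_distrib, hsum t] at this
    simp only [Finset.sum_const, Finset.card_univ, Fintype.card_fin, nsmul_eq_mul] at this
    rw [← mul_le_mul_iff_right₀ hM]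
    field_simp at this ⊢
    linarith
  have hlo : ∀ t, (M : ℝ)⁻¹ * (∫ s, h s) - M * e t ≤ a t m := by
    intro t
    have : ∑ m', a t m' ≤ ∑ _m' : Fin M, (a t m + M * e t) :=
      Finset.sum_le_sum fun m' _ => hcomp t m m'
    rw [hsum t] at this
    simp only [Finset.sum_const, Finset.card_univ, Fintype.card_fin, nsmul_eq_mul] at this
    rw [← mul_le_mul_iff_right₀ hM]
    field_simp at this ⊢
    linarith
  refine tendsto_of_tendsto_of_tendsto_of_le_of_le ?_ ?_ hlo hup
  · simpa using (he0.const_mul (M : ℝ)).const_sub ((M : ℝ)⁻¹ * ∫ s, h s)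
  · simpa using (he0.const_mul (M : ℝ)).const_add ((M : ℝ)⁻¹ * ∫ s, h s)

/-- The error probability of a one-time-padded code equals that of the underlying code on the
state-free channel. -/
lemma errProbG_eq {n M : ℕ} [NeZero M] {Q N : ℝ} (hQ : 0 < Q) (hN : 0 < N)
    (c : Fin M → Fin n → ℝ) {dec : (Fin n → ℝ) → Fin M} (hdec : Measurable dec)
    {k : (Fin n → ℝ) → Fin M} (hk : Measurable k) :
    errProbG n Q N (fun m s => c (m + k s)) (fun y s => dec (fun i => y i - s i) - k s) =
      (M : ℝ)⁻¹ * ∑ m, (gaussVec n N).real {w | dec (c m + w) ≠ m} := by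
  set e : Fin M → ℝ := fun m => (gaussVec n N).real {w | dec (c m + w) ≠ m} with he
  have hes : ∀ m, MeasurableSet {w | dec (c m + w) ≠ m} := fun m =>
    (hdec.comp (measurable_const_add (c m))) (measurableSet_singleton m).compl
  have hinner : ∀ (m : Fin M) (s : Fin n → ℝ), ∫ w : Fin n → ℝ,
      (∏ i, gpdf Q (s i)) * (∏ i, gpdf N (w i)) *
        (if dec (fun i => c (m + k s) i + s i + w i - s i) - k s = m then 0 else 1) =
      (∏ i, gpdf Q (s i)) * e (m + k s) := by
    intro m s
    simp_rw [mul_assoc]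
    rw [integral_const_mul, ← integral_gaussVec n hN, he]
    simp only
    rw [← integral_indicator_one (hes _)]
    congr 1
    refine integral_congr_ae (ae_of_all _ fun w => ?_)
    have h1 : (fun i => c (m + k s) i + s i + w i - s i) = c (m + k s) + w := by
      ext i; simp only [Pi.add_apply]; ring
    simp only [h1, Set.indicator, Set.mem_ofPred_eq, Pi.one_apply, sub_eq_iff_eq_add, ne_eq,
      ite_not]
  have hei : ∀ m, Integrable fun s : Fin n → ℝ => (∏ i, gpdf Q (s i)) * e (m + k s) := fun m =>
    (integrable_prod_gpdf n hQ).mul_bdd (c := 1)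
      ((Measurable.of_discrete (f := e)).comp (hk.const_add m)).aestronglyMeasurable
      (ae_of_all _ fun s => by
        rw [Real.norm_of_nonneg measureReal_nonneg]; exact measureReal_le_one)
  unfold errProbG
  simp_rw [hinner]
  rw [← Finset.mul_sum, ← integral_finsetSum _ fun m _ => hei m]
  congr 1
  have hs : ∀ s : Fin n → ℝ, ∑ m, (∏ i, gpdf Q (s i)) * e (m + k s) =
      (∏ i, gpdf Q (s i)) * ∑ m, e m := fun s => by
    rw [← Finset.mul_sum, ← Equiv.sum_comp (Equiv.addRight (k s)) e]; rfl
  simp_rw [hs]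
  rw [integral_mul_const, integral_prod_gpdf n hQ, one_mul]

lemma norm_mul_logb_div_le {q Q : ℝ} (hq : 0 ≤ q) (hqQ : q ≤ Q) :
    ‖q * Real.logb 2 (Q / q)‖ ≤ Q / Real.log 2 := by
  rcases hq.eq_or_lt with rfl | hq
  · simpa using div_nonneg hqQ (Real.log_pos one_lt_two).le
  have hl : 0 < Real.log 2 := Real.log_pos one_lt_two
  have h1 : 1 ≤ Q / q := (one_le_div hq).2 hqQ
  have h2 : 0 ≤ Real.log (Q / q) := Real.log_nonneg h1
  have h3 := Real.log_le_sub_one_of_pos (zero_lt_one.trans_le h1)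
  rw [Real.logb, Real.norm_of_nonneg (by positivity), ← mul_div_assoc]
  gcongr
  calc q * Real.log (Q / q) ≤ q * (Q / q - 1) := by gcongr
    _ = Q - q := by field_simp
    _ ≤ Q := by linarith

/-- Joint density of the state and the eavesdropper's output for the fixed input `c`. -/
noncomputable def jointDens {n : ℕ} (Q N : ℝ) (c z s : Fin n → ℝ) : ℝ :=
  (∏ i, gpdf Q (s i)) * ∏ i, gpdf N (z i - (c i + s i))

section jointDens

variable {n : ℕ} {Q N : ℝ}

lemma continuous_uncurry_jointDens (c : Fin n → ℝ) :
    Continuous fun p : (Fin n → ℝ) × (Fin n → ℝ) => jointDens Q N c p.1 p.2 := by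
  unfold jointDens
  have := continuous_gpdf Q
  have := continuous_gpdf N
  fun_prop

lemma integral_jointDens_left (hN : 0 < N) (c s : Fin n → ℝ) :
    Integrable (fun z => jointDens Q N c z s) ∧
      ∫ z, jointDens Q N c z s = ∏ i, gpdf Q (s i) := by
  unfold jointDens
  have h1 : ∀ z : Fin n → ℝ, ∏ i, gpdf N (z i - (c i + s i)) =
      (fun y : Fin n → ℝ => ∏ i, gpdf N (y i)) (z - (c + s)) := fun z => by simp
  simp_rw [h1]
  refine ⟨((integrable_prod_gpdf n hN).comp_sub_right (c + s)).const_mul _, ?_⟩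
  rw [integral_const_mul,
    integral_sub_right_eq_self (fun y : Fin n → ℝ => ∏ i, gpdf N (y i)),
    integral_prod_gpdf n hN, mul_one]

lemma jointDens_pos (hQ : 0 < Q) (hN : 0 < N) (c z s : Fin n → ℝ) : 0 < jointDens Q N c z s :=
  mul_pos (prod_gpdf_pos hQ s) (Finset.prod_pos fun _ _ => gpdf_pos hN _)

lemma integrable_uncurry_jointDens (hQ : 0 < Q) (hN : 0 < N) (c : Fin n → ℝ) :
    Integrable (fun p : (Fin n → ℝ) × (Fin n → ℝ) => jointDens Q N c p.1 p.2)
      (volume.prod volume) := by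
  rw [integrable_prod_iff' (continuous_uncurry_jointDens c).aestronglyMeasurable]
  refine ⟨ae_of_all _ fun s => (integral_jointDens_left hN c s).1, ?_⟩
  simp_rw [Real.norm_of_nonneg (jointDens_pos hQ hN _ _ _).le]
  simp_rw [(integral_jointDens_left hN c _).2]
  exact integrable_prod_gpdf n hQ

lemma integrable_jointDens_right (hQ : 0 < Q) (hN : 0 < N) (c z : Fin n → ℝ) :
    Integrable (fun s => jointDens Q N c z s) := by
  refine (integrable_prod_gpdf n hQ).mul_bdd (c := (Real.sqrt (2 * π * N))⁻¹ ^ n) ?_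
    (ae_of_all _ fun s => ?_)
  · have := continuous_gpdf N
    exact Continuous.aestronglyMeasurable (by fun_prop)
  · rw [Real.norm_of_nonneg (Finset.prod_nonneg fun _ _ => (gpdf_pos hN _).le)]
    calc ∏ i, gpdf N (z i - (c i + s i)) ≤ ∏ _i : Fin n, (Real.sqrt (2 * π * N))⁻¹ := by
          refine Finset.prod_le_prod (fun _ _ => (gpdf_pos hN _).le) fun i _ => ?_
          refine mul_le_of_le_one_right (by positivity) (Real.exp_le_one_iff.2 ?_)
          exact div_nonpos_of_nonpos_of_nonneg (neg_nonpos.2 (sq_nonneg _)) (by positivity)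
      _ = _ := by simp

lemma integral_jointDens_right_pos (hQ : 0 < Q) (hN : 0 < N) (c z : Fin n → ℝ) : 0 < ∫ s, jointDens Q N c z s := by
  refine (integral_pos_iff_support_of_nonneg (fun s => (jointDens_pos hQ hN c z s).le)
    (integrable_jointDens_right hQ hN c z)).2 ?_
  have : Function.support (fun s => jointDens Q N c z s) = Set.univ :=
    Set.eq_univ_of_forall fun s => (jointDens_pos hQ hN c z s).ne'
  rw [this]
  exact isOpen_univ.measure_pos volume Set.univ_nonempty

lemma integral_integral_jointDens (hQ : 0 < Q) (hN : 0 < N) (c : Fin n → ℝ) :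
    ∫ z, ∫ s, jointDens Q N c z s = 1 := by
  rw [integral_integral_swap (integrable_uncurry_jointDens hQ hN c)]
  simp_rw [(integral_jointDens_left hN c _).2]
  exact integral_prod_gpdf n hQ

end jointDens

section padded

variable {n M : ℕ} {Q N : ℝ} (c : Fin M → Fin n → ℝ)

/-- Density of the eavesdropper's output when the codeword index is uniform. -/
noncomputable def mixDens (Q N : ℝ) (z : Fin n → ℝ) : ℝ :=
  (M : ℝ)⁻¹ * ∑ j, ∫ s, jointDens Q N (c j) z s

lemma measurable_outDens [NeZero M] {k : (Fin n → ℝ) → Fin M} (hk : Measurable k) (m : Fin M) :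
    Measurable (outDens n Q N (fun m s => c (m + k s)) m) := by
  have hf : Measurable fun s => c (m + k s) :=
    (Measurable.of_discrete (f := c)).comp (hk.const_add m)
  have h : Measurable fun p : (Fin n → ℝ) × (Fin n → ℝ) =>
      (∏ i, gpdf Q (p.2 i)) * ∏ i, gpdf N (p.1 i - (c (m + k p.2) i + p.2 i)) := by
    have h1 := (continuous_gpdf Q).measurable
    have h2 := (continuous_gpdf N).measurable
    have h3 : ∀ i, Measurable fun p : (Fin n → ℝ) × (Fin n → ℝ) => c (m + k p.2) i := fun i =>
      ((measurable_pi_apply i).comp hf).comp measurable_snd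
    refine Measurable.mul (Finset.measurable_fun_prod _ fun i _ => by fun_prop)
      (Finset.measurable_fun_prod _ fun i _ => h2.comp ?_)
    exact ((measurable_pi_apply i).comp measurable_fst).sub
      ((h3 i).add ((measurable_pi_apply i).comp measurable_snd))
  exact (h.stronglyMeasurable.integral_prod_right (ν := volume)).measurable

lemma integrable_ite_jointDens [NeZero M] (hQ : 0 < Q) (hN : 0 < N) {k : (Fin n → ℝ) → Fin M} (hk : Measurable k) (m j : Fin M)
    (z : Fin n → ℝ) :
    Integrable fun s => if m + k s = j then jointDens Q N (c j) z s else 0 :=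
  ((integrable_jointDens_right hQ hN (c j) z).indicator
    ((hk.const_add m) (measurableSet_singleton j))).congr
      (ae_of_all _ fun s => by simp [Set.indicator])

lemma outDens_eq_sum [NeZero M] (hQ : 0 < Q) (hN : 0 < N) {k : (Fin n → ℝ) → Fin M} (hk : Measurable k) (m : Fin M) (z : Fin n → ℝ) :
    outDens n Q N (fun m s => c (m + k s)) m z =
      ∑ j, ∫ s, if m + k s = j then jointDens Q N (c j) z s else 0 := by
  rw [← integral_finsetSum _ fun j _ => integrable_ite_jointDens c hQ hN hk m j z]
  refine integral_congr_ae (ae_of_all _ fun s => ?_)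
  simp [jointDens]

lemma outDens_nonneg (hQ : 0 < Q) (hN : 0 < N) {M' : ℕ} (f : Fin M' → (Fin n → ℝ) → Fin n → ℝ) (m : Fin M')
    (z : Fin n → ℝ) : 0 ≤ outDens n Q N f m z :=
  integral_nonneg fun _ => mul_nonneg (Finset.prod_nonneg fun _ _ => (gpdf_pos hQ _).le)
    (Finset.prod_nonneg fun _ _ => (gpdf_pos hN _).le)

lemma sum_outDens [NeZero M] (hQ : 0 < Q) (hN : 0 < N) {k : (Fin n → ℝ) → Fin M} (hk : Measurable k) (z : Fin n → ℝ) :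
    ∑ m, (M : ℝ)⁻¹ * outDens n Q N (fun m s => c (m + k s)) m z = mixDens c Q N z := by
  simp_rw [outDens_eq_sum c hQ hN hk, mixDens]
  rw [← Finset.mul_sum, Finset.sum_comm]
  congr 1
  refine Finset.sum_congr rfl fun j _ => ?_
  rw [← integral_finsetSum _ fun m _ => integrable_ite_jointDens c hQ hN hk m j z]
  refine integral_congr_ae (ae_of_all _ fun s => ?_)
  simp only
  rw [Finset.sum_eq_single (j - k s)]
  · simp
  · exact fun m _ hm => if_neg fun hcon => hm (eq_sub_of_add_eq hcon)
  · simp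

lemma mixDens_pos [NeZero M] (hQ : 0 < Q) (hN : 0 < N) (z : Fin n → ℝ) : 0 < mixDens c Q N z :=
  mul_pos (inv_pos.2 (Nat.cast_pos.2 (NeZero.pos M)))
    (Finset.sum_pos (fun _ _ => integral_jointDens_right_pos hQ hN _ _) Finset.univ_nonempty)

lemma integrable_mixDens (hQ : 0 < Q) (hN : 0 < N) : Integrable (mixDens c Q N) :=
  (integrable_finsetSum _ fun j _ =>
    (integrable_uncurry_jointDens hQ hN (c j)).integral_prod_left).const_mul _

lemma integral_mixDens [NeZero M] (hQ : 0 < Q) (hN : 0 < N) : ∫ z, mixDens c Q N z = 1 := by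
  unfold mixDens
  rw [integral_const_mul, integral_finsetSum _ fun j _ =>
    (integrable_uncurry_jointDens hQ hN (c j)).integral_prod_left]
  simp_rw [integral_integral_jointDens hQ hN]
  simp [NeZero.ne M]

open Filter Topology

lemma tendsto_outDens [NeZero M] (hQ : 0 < Q) (hN : 0 < N) (i₀ : Fin n) (m : Fin M) (z : Fin n → ℝ) :
    Tendsto (fun t => outDens n Q N (fun m s => c (m + stateKey i₀ M t s)) m z) atTop
      (𝓝 (mixDens c Q N z)) := by
  have h : ∀ j, Tendsto
      (fun t => ∫ s, if m + stateKey i₀ M t s = j then jointDens Q N (c j) z s else 0) atTop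
      (𝓝 ((M : ℝ)⁻¹ * ∫ s, jointDens Q N (c j) z s)) := fun j => by
    have hc : Continuous fun s => jointDens Q N (c j) z s := by
      unfold jointDens
      have := continuous_gpdf Q
      have := continuous_gpdf N
      fun_prop
    exact tendsto_integral_stateKey i₀ M hc (integrable_jointDens_right hQ hN _ _)
      (fun s => (jointDens_pos hQ hN _ _ _).le) m j
  rw [mixDens, Finset.mul_sum]
  exact (tendsto_finsetSum Finset.univ fun j _ => h j).congr fun t =>
    (outDens_eq_sum c hQ hN (measurable_stateKey i₀ M t) m z).symm

/-- A one-time pad keyed by ever finer state quantization cells has asymptotically full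
equivocation. -/
lemma tendsto_equivocation [NeZero M] (hQ : 0 < Q) (hN : 0 < N) (i₀ : Fin n) :
    Tendsto (fun t => equivocation n Q N (fun m s => c (m + stateKey i₀ M t s))) atTop
      (𝓝 (Real.logb 2 M)) := by
  have hM : (0 : ℝ) < M := Nat.cast_pos.2 (NeZero.pos M)
  have hlim : ∫ z, mixDens c Q N z * Real.logb 2 M = Real.logb 2 M := by
    rw [integral_mul_const, integral_mixDens c hQ hN, one_mul]
  have hk := fun t => measurable_stateKey i₀ M t
  rw [← hlim]
  unfold equivocation
  simp_rw [sum_outDens c hQ hN (hk _)]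
  refine tendsto_integral_of_dominated_convergence
    (fun z => M * (mixDens c Q N z / Real.log 2)) (fun t => ?_)
    (((integrable_mixDens c hQ hN).div_const _).const_mul _)
    (fun t => ae_of_all _ fun z => ?_) (ae_of_all _ fun z => ?_)
  · have h1 : Measurable (mixDens c Q N) := by
      rw [← funext (sum_outDens c hQ hN (hk t))]
      exact Finset.measurable_fun_sum _ fun m _ => (measurable_outDens c (hk t) m).const_mul _
    refine Measurable.aestronglyMeasurable (Finset.measurable_fun_sum _ fun m _ => ?_)
    have h2 := (measurable_outDens (Q := Q) (N := N) c (hk t) m).const_mul (M : ℝ)⁻¹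
    exact h2.mul ((Real.measurable_log.comp (h1.div h2)).div_const _)
  · refine (norm_sum_le _ _).trans ?_
    calc _ ≤ ∑ _m : Fin M, mixDens c Q N z / Real.log 2 := by
          refine Finset.sum_le_sum fun m _ => norm_mul_logb_div_le
            (mul_nonneg (by positivity) (outDens_nonneg hQ hN _ _ _)) ?_
          rw [← sum_outDens c hQ hN (hk t) z]
          exact Finset.single_le_sum
            (f := fun m => (M : ℝ)⁻¹ * outDens n Q N (fun m s => c (m + stateKey i₀ M t s)) m z)
            (fun m _ => mul_nonneg (by positivity) (outDens_nonneg hQ hN _ _ _))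
            (Finset.mem_univ m)
      _ = _ := by simp
  · have hp := mixDens_pos c hQ hN z
    have hval : mixDens c Q N z * Real.logb 2 M = ∑ _m : Fin M,
        ((M : ℝ)⁻¹ * mixDens c Q N z) *
          Real.logb 2 (mixDens c Q N z / ((M : ℝ)⁻¹ * mixDens c Q N z)) := by
      have : mixDens c Q N z / ((M : ℝ)⁻¹ * mixDens c Q N z) = M := by field_simp
      rw [this, Finset.sum_const, Finset.card_univ, Fintype.card_fin, nsmul_eq_mul]
      field_simp
    rw [hval]
    refine tendsto_finsetSum _ fun m _ => ?_
    have h1 := (tendsto_outDens c hQ hN i₀ m z).const_mul (M : ℝ)⁻¹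
    have h2 : (M : ℝ)⁻¹ * mixDens c Q N z ≠ 0 := by positivity
    exact h1.mul (((tendsto_const_nhds.div h1 h2).log (by positivity)).div_const _)

end padded

/-- **Gaussian wiretap channel with state known at encoder and decoder.**
For the channel `Y = X + S + W₁`, `Z = X + S + W₃` with `S ~ 𝒩(0,Q₁)`,
`W₁ ~ 𝒩(0,N₁)`, `W₃ ~ 𝒩(0,N₃)` i.i.d. across uses, state known non-causally at
both the encoder and the legitimate decoder, and input power constraint `P`, the
capacity `½·log₂(1+P/N₁)` of the channel with state (without secrecy constraint)
is achievable with weak secrecy: every `R < ½·log₂(1+P/N₁)` is achievable. -/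
theorem gaussian_wiretap_state_encoder_decoder
    (P Q₁ N₁ N₃ : ℝ) (hP : 0 < P) (hQ₁ : 0 < Q₁) (hN₁ : 0 < N₁) (hN₃ : 0 < N₃)
    (R : ℝ) (hR : R < (1 / 2) * Real.logb 2 (1 + P / N₁)) :
    ∀ ε : ℝ, 0 < ε →
      ∃ (n M : ℕ) (f : Fin M → (Fin n → ℝ) → Fin n → ℝ)
        (g : (Fin n → ℝ) → (Fin n → ℝ) → Fin M),
        0 < n ∧ 0 < M ∧
        Measurable (fun p : Fin M × (Fin n → ℝ) => f p.1 p.2) ∧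
        (∀ m : Fin M, MeasurableSet {p : (Fin n → ℝ) × (Fin n → ℝ) | g p.1 p.2 = m}) ∧
        (∀ m : Fin M, ∀ᵐ s : Fin n → ℝ, ∑ i, (f m s i) ^ 2 ≤ (n : ℝ) * P) ∧
        Real.logb 2 M / n ≥ R - ε ∧
        equivocation n Q₁ N₃ f / n ≥ R - ε ∧
        errProbG n Q₁ N₁ f g ≤ ε := by
  intro ε hε
  have hl2 : 0 < Real.log 2 := Real.log_pos one_lt_two
  have hr : (R - ε) * Real.log 2 < 1 / 2 * Real.log (1 + P / N₁) := by
    have h1 : R - ε < 1 / 2 * Real.log (1 + P / N₁) / Real.log 2 := by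
      rw [mul_div_assoc]; exact (sub_lt_self R hε).trans hR
    exact (lt_div_iff₀ hl2).1 h1
  obtain ⟨n, M, hn, hM, hrate, c, hc, dec, hdec, herr⟩ := exists_awgn_code hP hN₁ hr hε
  have : NeZero M := ⟨hM.ne'⟩
  have hn' : (0 : ℝ) < n := Nat.cast_pos.2 hn
  have hM' : (0 : ℝ) < M := Nat.cast_pos.2 hM
  have hrate' : n * (R - ε) < Real.logb 2 M := by
    rw [Real.logb, lt_div_iff₀ hl2, mul_assoc]
    exact hrate
  obtain ⟨t, ht⟩ := ((tendsto_equivocation c hQ₁ hN₃ ⟨0, hn⟩).eventually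
    (lt_mem_nhds hrate')).exists
  have hk := measurable_stateKey (⟨0, hn⟩ : Fin n) M t
  refine ⟨n, M, fun m s => c (m + stateKey ⟨0, hn⟩ M t s),
    fun y s => dec (fun i => y i - s i) - stateKey ⟨0, hn⟩ M t s, hn, hM, ?_, fun m => ?_,
    fun m => ae_of_all _ fun s => hc _, ?_, ?_, ?_⟩
  · exact (Measurable.of_discrete (f := c)).comp (measurable_fst.add (hk.comp measurable_snd))
  · have hd : Measurable fun p : (Fin n → ℝ) × (Fin n → ℝ) => dec fun i => p.1 i - p.2 i :=
      hdec.comp (by fun_prop)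
    exact (hd.sub (hk.comp measurable_snd)) (measurableSet_singleton m)
  · exact (le_div_iff₀ hn').2 (by linarith)
  · exact (le_div_iff₀ hn').2 (by linarith)
  · rw [errProbG_eq hQ₁ hN₁ c hdec hk, inv_mul_le_iff₀ hM']
    have h := ENNReal.toReal_mono (by finiteness) herr
    rwa [ENNReal.toReal_sum (fun _ _ => measure_ne_top _ _), ENNReal.toReal_mul,
      ENNReal.toReal_ofReal hε.le, ENNReal.toReal_natCast] at h
end
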